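/- arXiv:2605.13582 — 3 statements merged into one kernel-verified Lean document; each statement's English description precedes it below -/
import Mathlib

section
/- (Corollary 2.3: L^1 difference bounds.) There exists a constant C > 0 such that for every r > 0 and every h ∈ ℝ^d: ‖Δ_x^h K_r‖_{L^1(ℝ^{1+2d})} + ‖Δ_x^h K⃗^π_r‖_{L^1(ℝ^{1+2d})} + ‖Δ_x^h K⃗_r‖_{L^1(ℝ^{1+2d})} ≤ C min{1, |h| r^{−3}}. -/
open MeasureTheory Real ENNReal
open scoped RealInnerProductSpace

noncomputable section

/-- Euclidean space `ℝ^d`. -/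
abbrev V (d : ℕ) : Type := EuclideanSpace ℝ (Fin d)

/-- The kinetic phase space `ℝ^{1+2d}`, with points `(t, x, v)`. -/
abbrev Pt (d : ℕ) : Type := ℝ × V d × V d

/-- Kinetic composition `(t,x,v) ∘ (s,y,w) = (t+s, x+y+s v, v+w)`. -/
def kmul {d : ℕ} (a b : Pt d) : Pt d :=
  (a.1 + b.1, a.2.1 + b.2.1 + b.1 • a.2.2, a.2.2 + b.2.2)

/-- Kinetic inverse `(t,x,v)⁻¹ = (−t, −x+t v, −v)`. -/
def kinv {d : ℕ} (a : Pt d) : Pt d :=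
  (-a.1, -a.2.1 + a.1 • a.2.2, -a.2.2)

/-- `g₁(r) = r³ sin(log r)`, extended by `0` at `r = 0`. -/
def g1 (r : ℝ) : ℝ := r ^ 3 * Real.sin (Real.log r)

/-- `g₂(r) = r³ cos(log r)`, extended by `0` at `r = 0`. -/
def g2 (r : ℝ) : ℝ := r ^ 3 * Real.cos (Real.log r)

/-- `ġ₁(r)/(2r) = (r/2)(3 sin(log r) + cos(log r))`, extended by `0` at `r = 0`. -/
def h1 (r : ℝ) : ℝ := r / 2 * (3 * Real.sin (Real.log r) + Real.cos (Real.log r))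

/-- `ġ₂(r)/(2r) = (r/2)(3 cos(log r) − sin(log r))`, extended by `0` at `r = 0`. -/
def h2 (r : ℝ) : ℝ := r / 2 * (3 * Real.cos (Real.log r) - Real.sin (Real.log r))

/-- The matrix `W(r)`, recorded through its scalar block entries as a `2×2` real matrix;
the full `2d×2d` matrix is the blockwise tensor with `Id_d`. -/
def Wm (r : ℝ) : Matrix (Fin 2) (Fin 2) ℝ := !![g1 r, g2 r; h1 r, h2 r]

/-- The matrix `D_δ` (scalar block entries). -/
def Dm (δ : ℝ) : Matrix (Fin 2) (Fin 2) ℝ := !![δ, 0; 0, 1]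

/-- The matrix `E_δ(r)` (scalar block entries). -/
def Em (δ r : ℝ) : Matrix (Fin 2) (Fin 2) ℝ := !![1, δ * r ^ 2; 0, 1]

/-- `A_{m₀}(r) = D_{m₀} W(r) D_{m₀}⁻¹` (scalar block entries). -/
def Am (m0 r : ℝ) : Matrix (Fin 2) (Fin 2) ℝ := Dm m0 * Wm r * (Dm m0)⁻¹

/-- The action on `ℝ^d × ℝ^d` of a `2×2` block matrix whose blocks are the scalar
multiples of `Id_d` given by the entries of `M`. -/
def act {d : ℕ} (M : Matrix (Fin 2) (Fin 2) ℝ) (p : V d × V d) : V d × V d :=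
  (M 0 0 • p.1 + M 0 1 • p.2, M 1 0 • p.1 + M 1 1 • p.2)

/-- The kinetic trajectory `γ^m(r; (t,x,v))`. -/
def gammaK {d : ℕ} (m : Pt d) (z : Pt d) (r : ℝ) : Pt d :=
  (z.1 + m.1 * r ^ 2,
   (act (Em m.1 r) (z.2.1, z.2.2) + act (Am m.1 r) (m.2.1, m.2.2)).1,
   (act (Em m.1 r) (z.2.1, z.2.2) + act (Am m.1 r) (m.2.1, m.2.2)).2)

/-- Build a vector of `ℝ^d` from components. -/
def mkV {d : ℕ} (f : Fin d → ℝ) : V d := (EuclideanSpace.equiv (Fin d) ℝ).symm f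

/-- The argument `(s/r², A_{s/r²}(r)⁻¹ (y,w)ᵀ)` fed into `ψ`. -/
def psiArg {d : ℕ} (r : ℝ) (m : Pt d) : Pt d :=
  (m.1 / r ^ 2,
   (act ((Am (m.1 / r ^ 2) r)⁻¹) (m.2.1, m.2.2)).1,
   (act ((Am (m.1 / r ^ 2) r)⁻¹) (m.2.1, m.2.2)).2)

/-- The mollification kernel `K_r(s,y,w) = 2^d r^{−Q} ψ(s/r², A_{s/r²}(r)⁻¹(y,w)ᵀ)`,
with `Q = 4d+2`. -/
def Kker {d : ℕ} (ψ : Pt d → ℝ) (r : ℝ) (m : Pt d) : ℝ :=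
  2 ^ d * r ^ (-(4 * (d : ℤ) + 2)) * ψ (psiArg r m)

/-- The kernel `K̃_r(s,y,w) = −2^{d+1} s r^{−Q−1} ψ(s/r², A_{s/r²}(r)⁻¹(y,w)ᵀ)`. -/
def Ktil {d : ℕ} (ψ : Pt d → ℝ) (r : ℝ) (m : Pt d) : ℝ :=
  -(2 ^ (d + 1)) * m.1 * r ^ (-(4 * (d : ℤ) + 2) - 1) * ψ (psiArg r m)

/-- First coefficient of the forcing matrix `F_{m₀}(r)`: `(1/m₀) ∂_r (ġ₁(r)/(2r))`. -/
def F1 (m0 r : ℝ) : ℝ := (1 / m0) * deriv h1 r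

/-- Second coefficient of the forcing matrix `F_{m₀}(r)`: `∂_r (ġ₂(r)/(2r))`. -/
def F2 (r : ℝ) : ℝ := deriv h2 r

/-- The kernel `K⃗_r(s,y,w) = −2^d r^{−Q} ψ(⋯) F_{s/r²}(r) A_{s/r²}(r)⁻¹ (y,w)ᵀ ∈ ℝ^d`. -/
def Kvec {d : ℕ} (ψ : Pt d → ℝ) (r : ℝ) (m : Pt d) : V d :=
  (-(2 ^ d) * r ^ (-(4 * (d : ℤ) + 2)) * ψ (psiArg r m)) •
    (F1 (m.1 / r ^ 2) r • (act ((Am (m.1 / r ^ 2) r)⁻¹) (m.2.1, m.2.2)).1 +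
      F2 r • (act ((Am (m.1 / r ^ 2) r)⁻¹) (m.2.1, m.2.2)).2)

/-- The gradient of `u : ℝ^{1+2d} → ℝ` in the `x`-variables (the `m₁` block). -/
def gradX {d : ℕ} (u : Pt d → ℝ) (z : Pt d) : V d :=
  mkV fun i => fderiv ℝ u z (0, EuclideanSpace.single i 1, 0)

/-- The gradient of `u : ℝ^{1+2d} → ℝ` in the `v`-variables (the `m₂` block). -/
def gradV {d : ℕ} (u : Pt d → ℝ) (z : Pt d) : V d :=
  mkV fun i => fderiv ℝ u z (0, 0, EuclideanSpace.single i 1)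

/-- The kernel `K⃗^π_r(s,y,w)
  = 2^{d+1} s r^{−Q−1} [(A_{s/r²}(r)⁻¹)_{·;2}]ᵀ [∇_{(m₁,m₂)}ψ](⋯) ∈ ℝ^d`. -/
def Kpi {d : ℕ} (ψ : Pt d → ℝ) (r : ℝ) (m : Pt d) : V d :=
  (2 ^ (d + 1) * m.1 * r ^ (-(4 * (d : ℤ) + 2) - 1)) •
    ((Am (m.1 / r ^ 2) r)⁻¹ 0 1 • gradX ψ (psiArg r m) +
      (Am (m.1 / r ^ 2) r)⁻¹ 1 1 • gradV ψ (psiArg r m))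

/-- Kinetic convolution operator for scalar kernels:
`[T_J f](z) = ∫ J(z⁻¹ ∘ m) f(m) dm`. -/
def Tsc {d : ℕ} (J : Pt d → ℝ) (f : Pt d → ℝ) (z : Pt d) : ℝ :=
  ∫ m, J (kmul (kinv z) m) * f m

/-- Kinetic convolution operator for `ℝ^d`-valued kernels:
`[T_J f](z) = ∫ J(z⁻¹ ∘ m) · f(m) dm`. -/
def Tvec {d : ℕ} (J : Pt d → V d) (f : Pt d → V d) (z : Pt d) : ℝ :=
  ∫ m, ⟪J (kmul (kinv z) m), f m⟫

/-- The support and nonnegativity conditions on the bump function `ψ`: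
smooth, nonnegative, unit mass, supported in `(−2,−1) × B₁(0) × B₁(0)`. -/
structure IsKineticBump {d : ℕ} (ψ : Pt d → ℝ) : Prop where
  smooth : ContDiff ℝ (⊤ : ℕ∞) ψ
  nonneg : ∀ m, 0 ≤ ψ m
  mass : ∫ m, ψ m = 1
  supp : ∀ m : Pt d, ψ m ≠ 0 →
    m.1 ∈ Set.Ioo (-2 : ℝ) (-1) ∧ ‖m.2.1‖ < 1 ∧ ‖m.2.2‖ < 1

/-- The kinetic box `B_r^kin = {(s,y,w) : |s| < r², |y| < r³, |w| < r}`. -/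
def kinBox (d : ℕ) (r : ℝ) : Set (Pt d) :=
  {m | |m.1| < r ^ 2 ∧ ‖m.2.1‖ < r ^ 3 ∧ ‖m.2.2‖ < r}

/-- The closed kinetic box of scale `r` centred at `(0, c, 0)` in the last two variables, large
enough to contain the support of every kernel of scale `r`. -/
def kernelBox {d : ℕ} (r : ℝ) (c : V d) : Set (Pt d) :=
  Set.Icc (-2 * r ^ 2) (-r ^ 2) ×ˢ (Metric.closedBall c (3 * r ^ 3) ×ˢ
    Metric.closedBall 0 (4 * r))

/-- The closed set `[-2,-1] × B̄₁ × B̄₁` containing the support of a kinetic bump. -/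
def bumpBox (d : ℕ) : Set (Pt d) :=
  Set.Icc (-2) (-1) ×ˢ (Metric.closedBall 0 1 ×ˢ Metric.closedBall 0 1)

theorem isCompact_bumpBox (d : ℕ) : IsCompact (bumpBox d) :=
  isCompact_Icc.prod ((isCompact_closedBall _ _).prod (isCompact_closedBall _ _))

theorem Am_eq {m0 r : ℝ} (hm : m0 ≠ 0) :
    Am m0 r = !![g1 r, m0 * g2 r; h1 r / m0, h2 r] := by
  have hD : (Dm m0)⁻¹ = !![1 / m0, 0; 0, 1] := by
    apply Matrix.inv_eq_right_inv
    ext i j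
    fin_cases i <;> fin_cases j <;> simp [Dm, hm]
  rw [Am, hD]
  ext i j
  fin_cases i <;> fin_cases j <;> simp [Dm, Wm] <;> field_simp

theorem det_Wm (r : ℝ) : g1 r * h2 r - g2 r * h1 r = -(r ^ 4 / 2) := by
  simp only [g1, g2, h1, h2]
  linear_combination (-(r ^ 4 / 2)) * Real.sin_sq_add_cos_sq (Real.log r)

theorem Am_mul_inv {m0 r : ℝ} (hm : m0 ≠ 0) (hr : r ≠ 0) : Am m0 r * (Am m0 r)⁻¹ = 1 := by
  apply Matrix.mul_nonsing_inv
  rw [Am_eq hm, Matrix.det_fin_two_of]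
  have h : g1 r * h2 r - m0 * g2 r * (h1 r / m0) = -(r ^ 4 / 2) := by
    rw [← det_Wm]; field_simp
  rw [h, isUnit_iff_ne_zero, neg_ne_zero]
  positivity

theorem Am_inv_eq {m0 r : ℝ} (hm : m0 ≠ 0) (hr : r ≠ 0) :
    (Am m0 r)⁻¹ =
      !![-(2 / r ^ 4 * h2 r), 2 / r ^ 4 * (m0 * g2 r);
        2 / r ^ 4 * (h1 r / m0), -(2 / r ^ 4 * g1 r)] := by
  apply Matrix.inv_eq_right_inv
  have hdet := det_Wm r
  rw [Am_eq hm]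
  ext i j
  fin_cases i <;> fin_cases j <;> simp <;> field_simp <;> linarith

theorem act_mul {d : ℕ} (M N : Matrix (Fin 2) (Fin 2) ℝ) (p : V d × V d) :
    act (M * N) p = act M (act N p) := by
  simp only [act, Matrix.mul_apply, Fin.sum_univ_two, Prod.mk.injEq]
  constructor <;> module

theorem act_one {d : ℕ} (p : V d × V d) : act 1 p = p := by
  simp [act]

theorem act_add {d : ℕ} (M : Matrix (Fin 2) (Fin 2) ℝ) (p q : V d × V d) :
    act M (p + q) = act M p + act M q := by
  simp only [act, Prod.fst_add, Prod.snd_add, Prod.mk_add_mk, Prod.mk.injEq]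
  constructor <;> module

theorem abs_trig_le (θ : ℝ) :
    |3 * Real.sin θ + Real.cos θ| ≤ 4 ∧ |3 * Real.cos θ - Real.sin θ| ≤ 4 := by
  have := Real.neg_one_le_sin θ
  have := Real.sin_le_one θ
  have := Real.neg_one_le_cos θ
  have := Real.cos_le_one θ
  constructor <;> rw [abs_le] <;> constructor <;> linarith

theorem abs_g1_le {r : ℝ} (hr : 0 < r) : |g1 r| ≤ r ^ 3 := by
  rw [g1, abs_mul, abs_of_pos (pow_pos hr 3)]
  exact mul_le_of_le_one_right (by positivity) (Real.abs_sin_le_one _)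

theorem abs_g2_le {r : ℝ} (hr : 0 < r) : |g2 r| ≤ r ^ 3 := by
  rw [g2, abs_mul, abs_of_pos (pow_pos hr 3)]
  exact mul_le_of_le_one_right (by positivity) (Real.abs_cos_le_one _)

theorem abs_h1_le {r : ℝ} (hr : 0 < r) : |h1 r| ≤ 2 * r := by
  rw [h1, abs_mul, abs_of_pos (half_pos hr)]
  nlinarith [(abs_trig_le (Real.log r)).1]

theorem abs_h2_le {r : ℝ} (hr : 0 < r) : |h2 r| ≤ 2 * r := by
  rw [h2, abs_mul, abs_of_pos (half_pos hr)]
  nlinarith [(abs_trig_le (Real.log r)).2]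

theorem abs_deriv_h1_le {r : ℝ} (hr : 0 < r) : |deriv h1 r| ≤ 4 := by
  have hl := Real.hasDerivAt_log hr.ne'
  have h := ((hasDerivAt_id r).div_const 2).mul ((hl.sin.const_mul 3).add hl.cos)
  have e : deriv h1 r = 2 * Real.cos (Real.log r) + Real.sin (Real.log r) := by
    refine (HasDerivAt.deriv (f := h1) h).trans ?_
    simp only [id, Pi.add_apply]
    field_simp
    ring
  have := Real.neg_one_le_sin (Real.log r)
  have := Real.sin_le_one (Real.log r)
  have := Real.neg_one_le_cos (Real.log r)
  have := Real.cos_le_one (Real.log r)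
  rw [e, abs_le]
  constructor <;> linarith

theorem abs_deriv_h2_le {r : ℝ} (hr : 0 < r) : |deriv h2 r| ≤ 4 := by
  have hl := Real.hasDerivAt_log hr.ne'
  have h := ((hasDerivAt_id r).div_const 2).mul ((hl.cos.const_mul 3).sub hl.sin)
  have e : deriv h2 r = Real.cos (Real.log r) - 2 * Real.sin (Real.log r) := by
    refine (HasDerivAt.deriv (f := h2) h).trans ?_
    simp only [id, Pi.sub_apply]
    field_simp
    ring
  have := Real.neg_one_le_sin (Real.log r)
  have := Real.sin_le_one (Real.log r)
  have := Real.neg_one_le_cos (Real.log r)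
  have := Real.cos_le_one (Real.log r)
  rw [e, abs_le]
  constructor <;> linarith

theorem abs_div_le_of_one_le_abs {a b : ℝ} (hb : 1 ≤ |b|) : |a / b| ≤ |a| := by
  rw [abs_div]
  exact div_le_self (abs_nonneg a) hb

theorem one_le_abs_of_mem {m0 : ℝ} (hm : m0 ∈ Set.Icc (-2 : ℝ) (-1)) : 1 ≤ |m0| :=
  le_abs.2 (Or.inr (by linarith [hm.2]))

theorem abs_le_two_of_mem {m0 : ℝ} (hm : m0 ∈ Set.Icc (-2 : ℝ) (-1)) : |m0| ≤ 2 :=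
  abs_le.2 ⟨hm.1, by linarith [hm.2]⟩

theorem ne_zero_of_mem {m0 : ℝ} (hm : m0 ∈ Set.Icc (-2 : ℝ) (-1)) : m0 ≠ 0 := by
  rintro rfl
  linarith [hm.2]

/-- Entrywise bounds for `A_{m₀}(r)⁻¹`, uniform for `m₀ ∈ [-2,-1]`. -/
theorem abs_Am_inv_le {m0 r : ℝ} (hm : m0 ∈ Set.Icc (-2 : ℝ) (-1)) (hr : 0 < r) :
    |(Am m0 r)⁻¹ 0 0| ≤ 4 * r ^ (-3 : ℤ) ∧ |(Am m0 r)⁻¹ 1 0| ≤ 4 * r ^ (-3 : ℤ) ∧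
      |(Am m0 r)⁻¹ 0 1| ≤ 4 * r⁻¹ ∧ |(Am m0 r)⁻¹ 1 1| ≤ 4 * r⁻¹ := by
  have hz : r ^ (-3 : ℤ) = 1 / r ^ 3 := by
    rw [zpow_neg, one_div]; norm_cast
  have e3 : 4 * r ^ (-3 : ℤ) = 2 / r ^ 4 * (2 * r) := by
    rw [hz]; field_simp; norm_num
  have e1 : 4 * r⁻¹ = 2 / r ^ 4 * (2 * r ^ 3) := by
    field_simp; norm_num
  have hp : (0 : ℝ) ≤ 2 / r ^ 4 := by positivity
  rw [Am_inv_eq (ne_zero_of_mem hm) hr.ne', e3, e1]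
  simp only [Matrix.of_apply, Matrix.cons_val', Matrix.cons_val_zero, Matrix.cons_val_one,
    Matrix.cons_val_fin_one, abs_neg]
  simp only [abs_mul (2 / r ^ 4), abs_of_nonneg hp]
  refine ⟨?_, ?_, ?_, ?_⟩ <;> apply mul_le_mul_of_nonneg_left _ hp
  · exact abs_h2_le hr
  · exact (abs_div_le_of_one_le_abs (one_le_abs_of_mem hm)).trans (abs_h1_le hr)
  · rw [abs_mul]
    exact mul_le_mul (abs_le_two_of_mem hm) (abs_g2_le hr) (abs_nonneg _) (by norm_num)
  · linarith [abs_g1_le hr, pow_pos hr 3]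

theorem mem_kernelBox_of_psiArg_mem {d : ℕ} {r : ℝ} (hr : 0 < r) {m : Pt d}
    (h : psiArg r m ∈ bumpBox d) : m ∈ kernelBox r (0 : V d) := by
  obtain ⟨hs, hx, hv⟩ := h
  have hs' : m.1 / r ^ 2 ∈ Set.Icc (-2 : ℝ) (-1) := hs
  set z := act ((Am (m.1 / r ^ 2) r)⁻¹) (m.2.1, m.2.2) with hz
  have hx' : ‖z.1‖ ≤ 1 := by simpa [psiArg] using hx
  have hv' : ‖z.2‖ ≤ 1 := by simpa [psiArg] using hv
  have hm0 := ne_zero_of_mem hs'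
  have hA : act (Am (m.1 / r ^ 2) r) z = m.2 := by
    rw [hz, ← act_mul, Am_mul_inv hm0 hr.ne', act_one]
  rw [Am_eq hm0] at hA
  have hr2 : 0 < r ^ 2 := pow_pos hr 2
  refine ⟨⟨(le_div_iff₀ hr2).1 hs'.1, ?_⟩, ?_, ?_⟩
  · have := (div_le_iff₀ hr2).1 hs'.2
    linarith
  · rw [mem_closedBall_zero_iff, ← hA]
    simp only [act, Matrix.of_apply, Matrix.cons_val', Matrix.cons_val_zero, Matrix.cons_val_one,
      Matrix.cons_val_fin_one]
    refine (norm_add_le _ _).trans ?_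
    rw [norm_smul, norm_smul, Real.norm_eq_abs, Real.norm_eq_abs, abs_mul]
    have b1 := mul_le_mul (abs_g1_le hr) hx' (norm_nonneg _) (by positivity)
    have b2 := mul_le_mul (mul_le_mul (abs_le_two_of_mem hs') (abs_g2_le hr) (abs_nonneg _)
      (by norm_num)) hv' (norm_nonneg _) (by positivity)
    linarith
  · rw [mem_closedBall_zero_iff, ← hA]
    simp only [act, Matrix.of_apply, Matrix.cons_val', Matrix.cons_val_zero, Matrix.cons_val_one,
      Matrix.cons_val_fin_one]
    refine (norm_add_le _ _).trans ?_
    rw [norm_smul, norm_smul, Real.norm_eq_abs, Real.norm_eq_abs]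
    have b1 := mul_le_mul ((abs_div_le_of_one_le_abs (one_le_abs_of_mem hs')).trans
      (abs_h1_le hr)) hx' (norm_nonneg _) (by positivity)
    have b2 := mul_le_mul (abs_h2_le hr) hv' (norm_nonneg _) (by positivity)
    linarith

theorem norm_psiArg_sub_le {d : ℕ} {r : ℝ} (hr : 0 < r) (m : Pt d) (h : V d)
    (hs : m.1 / r ^ 2 ∈ Set.Icc (-2 : ℝ) (-1)) :
    ‖psiArg r (m.1, m.2.1 + h, m.2.2) - psiArg r m‖ ≤ 4 * (‖h‖ * r ^ (-3 : ℤ)) := by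
  obtain ⟨b0, b1, -, -⟩ := abs_Am_inv_le hs hr
  have e : (m.2.1 + h, m.2.2) = (m.2.1, m.2.2) + (h, (0 : V d)) := by
    rw [Prod.mk_add_mk, add_zero]
  have hd : psiArg r (m.1, m.2.1 + h, m.2.2) - psiArg r m =
      (0, (Am (m.1 / r ^ 2) r)⁻¹ 0 0 • h, (Am (m.1 / r ^ 2) r)⁻¹ 1 0 • h) := by
    simp only [psiArg, e, act_add]
    simp [act]
  have hn := norm_nonneg h
  have hz : 0 < r ^ (-3 : ℤ) := zpow_pos hr _
  rw [hd, Prod.norm_def, Prod.norm_def]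
  simp only [norm_zero, norm_smul, Real.norm_eq_abs]
  refine max_le (by positivity) (max_le ?_ ?_)
  · nlinarith
  · nlinarith

/-- Pointwise control of `x`-differences of a function of `psiArg`, with an `s`-dependent
coefficient. -/
theorem exists_norm_sub_le {d : ℕ} {E : Type*} [NormedAddCommGroup E] [NormedSpace ℝ E]
    {G : Pt d → E} (hG : ContDiff ℝ 1 G) (hsupp : ∀ z, G z ≠ 0 → z ∈ bumpBox d) :
    ∃ M : ℝ, 0 ≤ M ∧ ∀ r : ℝ, 0 < r → ∀ (b c : ℝ) (h : V d) (m : Pt d),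
      (m.1 / r ^ 2 ∈ Set.Icc (-2 : ℝ) (-1) → |c| ≤ b) → 0 ≤ b →
      ‖c • G (psiArg r (m.1, m.2.1 + h, m.2.2)) - c • G (psiArg r m)‖ ≤
        b * M * min 1 (‖h‖ * r ^ (-3 : ℤ)) *
          ((kernelBox r (0 : V d)).indicator 1 m + (kernelBox r (-h)).indicator 1 m) := by
  have hc : HasCompactSupport G :=
    HasCompactSupport.intro (isCompact_bumpBox d) fun z hz => by
      by_contra hne
      exact hz (hsupp z hne)
  obtain ⟨L, hL⟩ := hG.lipschitzWith_of_hasCompactSupport hc one_ne_zero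
  obtain ⟨N, hN⟩ := hc.exists_bound_of_continuous hG.continuous
  have hN0 : 0 ≤ N := (norm_nonneg _).trans (hN 0)
  refine ⟨4 * L + 2 * N, by positivity, fun r hr b c h m hcb hb => ?_⟩
  set t := ‖h‖ * r ^ (-3 : ℤ) with ht
  have ht0 : 0 ≤ t := by positivity
  set z := psiArg r m
  set z' := psiArg r (m.1, m.2.1 + h, m.2.2) with hz'
  have hi0 : (0 : ℝ) ≤ (kernelBox r (0 : V d)).indicator 1 m :=
    Set.indicator_nonneg (fun _ _ => zero_le_one) m
  have hih : (0 : ℝ) ≤ (kernelBox r (-h)).indicator 1 m :=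
    Set.indicator_nonneg (fun _ _ => zero_le_one) m
  by_cases hzero : G z = 0 ∧ G z' = 0
  · rw [hzero.1, hzero.2, smul_zero, sub_zero, norm_zero]
    have : 0 ≤ min 1 t := le_min zero_le_one ht0
    positivity
  have hs : m.1 / r ^ 2 ∈ Set.Icc (-2 : ℝ) (-1) := by
    by_cases h1 : G z = 0
    · exact (hsupp z' fun h2 => hzero ⟨h1, h2⟩).1
    · exact (hsupp z h1).1
  have hind : (1 : ℝ) ≤ (kernelBox r (0 : V d)).indicator 1 m +
      (kernelBox r (-h)).indicator 1 m := by
    by_cases h1 : G z = 0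
    · have hmem := mem_kernelBox_of_psiArg_mem hr (hsupp z' fun h2 => hzero ⟨h1, h2⟩)
      have : m ∈ kernelBox r (-h) := by
        obtain ⟨p1, p2, p3⟩ := hmem
        refine ⟨p1, ?_, p3⟩
        simpa [dist_eq_norm] using p2
      rw [Set.indicator_of_mem this, Pi.one_apply]
      linarith
    · rw [Set.indicator_of_mem (mem_kernelBox_of_psiArg_mem hr (hsupp z h1)), Pi.one_apply]
      linarith
  have hdiff : ‖G z' - G z‖ ≤ (4 * L + 2 * N) * min 1 t := by
    have h1 : ‖G z' - G z‖ ≤ 2 * N := by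
      linarith [norm_sub_le (G z') (G z), hN z, hN z']
    have h2 : ‖G z' - G z‖ ≤ 4 * L * t := by
      have := mul_le_mul_of_nonneg_left (norm_psiArg_sub_le hr m h hs) L.coe_nonneg
      have := hL.norm_sub_le z' z
      linarith
    rw [mul_min_of_nonneg _ _ (by positivity)]
    refine le_min ?_ ?_
    · have := L.coe_nonneg
      linarith
    · nlinarith
  rw [← smul_sub, norm_smul, Real.norm_eq_abs]
  calc |c| * ‖G z' - G z‖ ≤ b * ((4 * L + 2 * N) * min 1 t) :=
        mul_le_mul (hcb hs) hdiff (norm_nonneg _) hb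
    _ = b * (4 * L + 2 * N) * min 1 t * 1 := by ring
    _ ≤ _ := by
        have : 0 ≤ min 1 t := le_min zero_le_one ht0
        exact mul_le_mul_of_nonneg_left hind (by positivity)

theorem measurableSet_kernelBox {d : ℕ} (r : ℝ) (c : V d) : MeasurableSet (kernelBox r c) :=
  measurableSet_Icc.prod (Metric.isClosed_closedBall.measurableSet.prod
    Metric.isClosed_closedBall.measurableSet)

theorem volume_kernelBox_lt_top {d : ℕ} (r : ℝ) (c : V d) : volume (kernelBox r c) < ⊤ :=
  (isCompact_Icc.prod ((isCompact_closedBall c _).prod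
    (isCompact_closedBall 0 _))).measure_lt_top

theorem volume_real_kernelBox {d : ℕ} {r : ℝ} (hr : 0 < r) (c : V d) :
    volume.real (kernelBox r c) =
      12 ^ d * (volume.real (Metric.closedBall (0 : V d) 1)) ^ 2 * r ^ (4 * d + 2) := by
  have hball : ∀ (x : V d) {ρ : ℝ}, 0 ≤ ρ → volume.real (Metric.closedBall x ρ) =
      ρ ^ d * volume.real (Metric.closedBall (0 : V d) 1) := by
    intro x ρ hρ
    rw [Measure.addHaar_real_closedBall' _ _ hρ, finrank_euclideanSpace_fin]
  rw [kernelBox, Measure.volume_eq_prod, measureReal_prod_prod, Measure.volume_eq_prod,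
    measureReal_prod_prod, hball c (by positivity : 0 ≤ 3 * r ^ 3),
    hball 0 (by positivity : 0 ≤ 4 * r),
    Real.volume_real_Icc_of_le (by nlinarith [pow_pos hr 2])]
  have : (12 : ℝ) ^ d = 3 ^ d * 4 ^ d := by rw [← mul_pow]; norm_num
  rw [this]
  ring

/-- Integration of a pointwise bound by indicators of kernel boxes. -/
theorem integral_le_of_le_indicator {d : ℕ} {f : Pt d → ℝ} {r a : ℝ} {h : V d} (hr : 0 < r)
    (hf0 : ∀ m, 0 ≤ f m)
    (hf : ∀ m, f m ≤ r ^ (-(4 * (d : ℤ) + 2)) * a *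
      ((kernelBox r (0 : V d)).indicator 1 m + (kernelBox r (-h)).indicator 1 m)) :
    ∫ m, f m ≤ 2 * (12 ^ d * (volume.real (Metric.closedBall (0 : V d) 1)) ^ 2) * a := by
  have hint : ∀ c : V d, Integrable ((kernelBox r c).indicator (1 : Pt d → ℝ)) := fun c =>
    (integrable_indicator_iff (measurableSet_kernelBox r c)).2
      (integrableOn_const (volume_kernelBox_lt_top r c).ne)
  refine (integral_mono_of_nonneg (Filter.Eventually.of_forall hf0)
    (((hint 0).add (hint (-h))).const_mul _) (Filter.Eventually.of_forall hf)).trans_eq ?_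
  have hpow : r ^ (-(4 * (d : ℤ) + 2)) * r ^ (4 * d + 2) = 1 := by
    rw [zpow_neg, ← zpow_natCast]
    push_cast
    exact inv_mul_cancel₀ (zpow_ne_zero _ hr.ne')
  simp only [Pi.add_apply]
  rw [integral_const_mul, integral_add (hint 0) (hint (-h)),
    integral_indicator_one (measurableSet_kernelBox r 0),
    integral_indicator_one (measurableSet_kernelBox r (-h)),
    volume_real_kernelBox hr, volume_real_kernelBox hr]
  linear_combination (2 * (12 ^ d * (volume.real (Metric.closedBall (0 : V d) 1)) ^ 2) * a) * hpow

theorem IsKineticBump.mem_bumpBox {d : ℕ} {ψ : Pt d → ℝ} (hψ : IsKineticBump ψ) {z : Pt d}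
    (hz : z ∈ tsupport ψ) : z ∈ bumpBox d := by
  refine closure_minimal (fun m hm => ?_) (isCompact_bumpBox d).isClosed hz
  obtain ⟨h1, h2, h3⟩ := hψ.supp m hm
  exact ⟨Set.Ioo_subset_Icc_self h1, mem_closedBall_zero_iff.2 h2.le,
    mem_closedBall_zero_iff.2 h3.le⟩

theorem IsKineticBump.contDiff_fderiv {d : ℕ} {ψ : Pt d → ℝ} (hψ : IsKineticBump ψ) :
    ContDiff ℝ 1 (fderiv ℝ ψ) :=
  hψ.smooth.fderiv_right (WithTop.coe_le_coe.2 (le_top : (1 + 1 : ℕ∞) ≤ ⊤))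

theorem contDiff_mkV {d : ℕ} {f : Pt d → Fin d → ℝ} (hf : ∀ i, ContDiff ℝ 1 fun z => f z i) :
    ContDiff ℝ 1 fun z => mkV (f z) :=
  (EuclideanSpace.equiv (Fin d) ℝ).symm.contDiff.comp (contDiff_pi.2 hf)

theorem IsKineticBump.contDiff_gradX {d : ℕ} {ψ : Pt d → ℝ} (hψ : IsKineticBump ψ) :
    ContDiff ℝ 1 (gradX ψ) :=
  contDiff_mkV fun _ => hψ.contDiff_fderiv.clm_apply contDiff_const

theorem IsKineticBump.contDiff_gradV {d : ℕ} {ψ : Pt d → ℝ} (hψ : IsKineticBump ψ) :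
    ContDiff ℝ 1 (gradV ψ) :=
  contDiff_mkV fun _ => hψ.contDiff_fderiv.clm_apply contDiff_const

theorem IsKineticBump.mem_bumpBox_of_fderiv {d : ℕ} {ψ : Pt d → ℝ} (hψ : IsKineticBump ψ)
    {z : Pt d} (hz : fderiv ℝ ψ z ≠ 0) : z ∈ bumpBox d :=
  hψ.mem_bumpBox (support_fderiv_subset ℝ hz)

theorem IsKineticBump.mem_bumpBox_of_gradX {d : ℕ} {ψ : Pt d → ℝ} (hψ : IsKineticBump ψ)
    {z : Pt d} (hz : gradX ψ z ≠ 0) : z ∈ bumpBox d :=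
  hψ.mem_bumpBox_of_fderiv fun h0 => hz (by ext i; simp [gradX, mkV, h0])

theorem IsKineticBump.mem_bumpBox_of_gradV {d : ℕ} {ψ : Pt d → ℝ} (hψ : IsKineticBump ψ)
    {z : Pt d} (hz : gradV ψ z ≠ 0) : z ∈ bumpBox d :=
  hψ.mem_bumpBox_of_fderiv fun h0 => hz (by ext i; simp [gradV, mkV, h0])

theorem IsKineticBump.exists_integral_Kker_le {d : ℕ} {ψ : Pt d → ℝ} (hψ : IsKineticBump ψ) :
    ∃ C : ℝ, 0 ≤ C ∧ ∀ r : ℝ, 0 < r → ∀ h : V d,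
      (∫ m : Pt d, |Kker ψ r (m.1, m.2.1 + h, m.2.2) - Kker ψ r m|) ≤
        C * min 1 (‖h‖ * r ^ (-3 : ℤ)) := by
  obtain ⟨M, hM, H⟩ := exists_norm_sub_le (hψ.smooth.of_le (by exact_mod_cast le_top))
    fun z hz => hψ.mem_bumpBox (subset_tsupport _ hz)
  refine ⟨2 * (12 ^ d * (volume.real (Metric.closedBall (0 : V d) 1)) ^ 2) * (2 ^ d * M),
    by positivity, fun r hr h => ?_⟩
  refine (integral_le_of_le_indicator (a := 2 ^ d * M * min 1 (‖h‖ * r ^ (-3 : ℤ))) (h := h) hr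
    (fun m => abs_nonneg _) fun m => ?_).trans_eq (by ring)
  have hp : 0 < r ^ (-(4 * (d : ℤ) + 2)) := zpow_pos hr _
  refine (H r hr (2 ^ d * r ^ (-(4 * (d : ℤ) + 2))) (2 ^ d * r ^ (-(4 * (d : ℤ) + 2))) h m
    (fun _ => (abs_of_nonneg (by positivity)).le) (by positivity)).trans_eq ?_
  ring

/-- The `L¹` difference bound for kernels with two terms of the type treated in
`exists_norm_sub_le`. -/
theorem exists_integral_two_terms_le {d : ℕ} {E : Type*} [NormedAddCommGroup E]
    [NormedSpace ℝ E] {G₁ G₂ : Pt d → E} (hG₁ : ContDiff ℝ 1 G₁) (hG₂ : ContDiff ℝ 1 G₂)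
    (hs₁ : ∀ z, G₁ z ≠ 0 → z ∈ bumpBox d) (hs₂ : ∀ z, G₂ z ≠ 0 → z ∈ bumpBox d)
    {B : ℝ} (hB : 0 ≤ B) {c₁ c₂ : ℝ → ℝ → ℝ}
    (hc₁ : ∀ r s, 0 < r → s / r ^ 2 ∈ Set.Icc (-2 : ℝ) (-1) →
      |c₁ r s| ≤ B * r ^ (-(4 * (d : ℤ) + 2)))
    (hc₂ : ∀ r s, 0 < r → s / r ^ 2 ∈ Set.Icc (-2 : ℝ) (-1) →
      |c₂ r s| ≤ B * r ^ (-(4 * (d : ℤ) + 2)))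
    {J : ℝ → Pt d → E}
    (hJ : ∀ r m, J r m = c₁ r m.1 • G₁ (psiArg r m) + c₂ r m.1 • G₂ (psiArg r m)) :
    ∃ C : ℝ, 0 ≤ C ∧ ∀ r : ℝ, 0 < r → ∀ h : V d,
      (∫ m : Pt d, ‖J r (m.1, m.2.1 + h, m.2.2) - J r m‖) ≤
        C * min 1 (‖h‖ * r ^ (-3 : ℤ)) := by
  obtain ⟨M₁, hM₁, H₁⟩ := exists_norm_sub_le hG₁ hs₁
  obtain ⟨M₂, hM₂, H₂⟩ := exists_norm_sub_le hG₂ hs₂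
  refine ⟨2 * (12 ^ d * (volume.real (Metric.closedBall (0 : V d) 1)) ^ 2) * (B * (M₁ + M₂)),
    by positivity, fun r hr h => ?_⟩
  refine (integral_le_of_le_indicator (a := B * (M₁ + M₂) * min 1 (‖h‖ * r ^ (-3 : ℤ))) (h := h)
    hr (fun m => norm_nonneg _) fun m => ?_).trans_eq (by ring)
  have hp : 0 < r ^ (-(4 * (d : ℤ) + 2)) := zpow_pos hr _
  have k₁ := H₁ r hr (B * r ^ (-(4 * (d : ℤ) + 2))) (c₁ r m.1) h m (hc₁ r m.1 hr)
    (by positivity)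
  have k₂ := H₂ r hr (B * r ^ (-(4 * (d : ℤ) + 2))) (c₂ r m.1) h m (hc₂ r m.1 hr)
    (by positivity)
  rw [hJ, hJ, add_sub_add_comm]
  refine (norm_add_le _ _).trans ((add_le_add k₁ k₂).trans_eq ?_)
  ring

theorem IsKineticBump.exists_integral_Kpi_le {d : ℕ} {ψ : Pt d → ℝ} (hψ : IsKineticBump ψ) :
    ∃ C : ℝ, 0 ≤ C ∧ ∀ r : ℝ, 0 < r → ∀ h : V d,
      (∫ m : Pt d, ‖Kpi ψ r (m.1, m.2.1 + h, m.2.2) - Kpi ψ r m‖) ≤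
        C * min 1 (‖h‖ * r ^ (-3 : ℤ)) := by
  have key : ∀ r s a : ℝ, 0 < r → s / r ^ 2 ∈ Set.Icc (-2 : ℝ) (-1) → |a| ≤ 4 * r⁻¹ →
      |2 ^ (d + 1) * s * r ^ (-(4 * (d : ℤ) + 2) - 1) * a| ≤
        2 ^ (d + 1) * 8 * r ^ (-(4 * (d : ℤ) + 2)) := by
    intro r s a hr hs ha
    have hs2 : |s| ≤ 2 * r ^ 2 := by
      have := abs_le_two_of_mem hs
      rwa [abs_div, abs_of_pos (pow_pos hr 2), div_le_iff₀ (pow_pos hr 2)] at this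
    have hp : 0 < r ^ (-(4 * (d : ℤ) + 2)) := zpow_pos hr _
    rw [zpow_sub_one₀ hr.ne', abs_mul, abs_mul, abs_mul, abs_of_pos (mul_pos hp (inv_pos.2 hr)),
      abs_of_pos (by positivity : (0 : ℝ) < 2 ^ (d + 1))]
    calc 2 ^ (d + 1) * |s| * (r ^ (-(4 * (d : ℤ) + 2)) * r⁻¹) * |a|
        ≤ 2 ^ (d + 1) * (2 * r ^ 2) * (r ^ (-(4 * (d : ℤ) + 2)) * r⁻¹) * (4 * r⁻¹) := by gcongr
      _ = 2 ^ (d + 1) * 8 * r ^ (-(4 * (d : ℤ) + 2)) * (r * r⁻¹) ^ 2 := by ring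
      _ = _ := by rw [mul_inv_cancel₀ hr.ne']; ring
  refine exists_integral_two_terms_le hψ.contDiff_gradX hψ.contDiff_gradV
    (fun z => hψ.mem_bumpBox_of_gradX) (fun z => hψ.mem_bumpBox_of_gradV)
    (by positivity : (0 : ℝ) ≤ 2 ^ (d + 1) * 8)
    (fun r s hr hs => key r s _ hr hs (abs_Am_inv_le hs hr).2.2.1)
    (fun r s hr hs => key r s _ hr hs (abs_Am_inv_le hs hr).2.2.2) fun r m => ?_
  rw [Kpi, smul_add, smul_smul, smul_smul]

theorem IsKineticBump.exists_integral_Kvec_le {d : ℕ} {ψ : Pt d → ℝ} (hψ : IsKineticBump ψ) :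
    ∃ C : ℝ, 0 ≤ C ∧ ∀ r : ℝ, 0 < r → ∀ h : V d,
      (∫ m : Pt d, ‖Kvec ψ r (m.1, m.2.1 + h, m.2.2) - Kvec ψ r m‖) ≤
        C * min 1 (‖h‖ * r ^ (-3 : ℤ)) := by
  have hψ1 : ContDiff ℝ 1 ψ := hψ.smooth.of_le (by exact_mod_cast le_top)
  have key : ∀ r a : ℝ, 0 < r → |a| ≤ 4 →
      |-(2 ^ d) * r ^ (-(4 * (d : ℤ) + 2)) * a| ≤ 2 ^ d * 4 * r ^ (-(4 * (d : ℤ) + 2)) := by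
    intro r a hr ha
    have hp : 0 < r ^ (-(4 * (d : ℤ) + 2)) := zpow_pos hr _
    rw [abs_mul, abs_mul, abs_neg, abs_of_pos hp, abs_of_pos (by positivity : (0 : ℝ) < 2 ^ d)]
    calc 2 ^ d * r ^ (-(4 * (d : ℤ) + 2)) * |a| ≤ 2 ^ d * r ^ (-(4 * (d : ℤ) + 2)) * 4 := by gcongr
      _ = _ := by ring
  refine exists_integral_two_terms_le (G₁ := fun z => ψ z • z.2.1) (G₂ := fun z => ψ z • z.2.2)
    (hψ1.smul (by fun_prop)) (hψ1.smul (by fun_prop))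
    (fun z hz => hψ.mem_bumpBox (subset_tsupport _ (left_ne_zero_of_smul hz)))
    (fun z hz => hψ.mem_bumpBox (subset_tsupport _ (left_ne_zero_of_smul hz)))
    (by positivity : (0 : ℝ) ≤ 2 ^ d * 4)
    (c₁ := fun r s => -(2 ^ d) * r ^ (-(4 * (d : ℤ) + 2)) * F1 (s / r ^ 2) r)
    (c₂ := fun r s => -(2 ^ d) * r ^ (-(4 * (d : ℤ) + 2)) * F2 r)
    (fun r s hr hs => key r _ hr ?_)
    (fun r s hr hs => key r _ hr (abs_deriv_h2_le hr)) fun r m => ?_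
  · rw [F1, one_div_mul_eq_div]
    exact (abs_div_le_of_one_le_abs (one_le_abs_of_mem hs)).trans (abs_deriv_h1_le hr)
  · simp only [Kvec, psiArg]
    module

/-- **Corollary 2.3: L¹ difference bounds.** There is `C > 0` such that for every `r > 0`
and every `h ∈ ℝ^d`:
`‖Δ_x^h K_r‖_{L¹} + ‖Δ_x^h K⃗^π_r‖_{L¹} + ‖Δ_x^h K⃗_r‖_{L¹} ≤ C min{1, |h| r⁻³}`. -/
theorem statement10 (d : ℕ) (hd : 1 ≤ d) (ψ : Pt d → ℝ) (hψ : IsKineticBump ψ) :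
    ∃ C : ℝ, 0 < C ∧ ∀ r : ℝ, 0 < r → ∀ h : V d,
      (∫ m : Pt d, |Kker ψ r (m.1, m.2.1 + h, m.2.2) - Kker ψ r m|) +
      (∫ m : Pt d, ‖Kpi ψ r (m.1, m.2.1 + h, m.2.2) - Kpi ψ r m‖) +
      (∫ m : Pt d, ‖Kvec ψ r (m.1, m.2.1 + h, m.2.2) - Kvec ψ r m‖) ≤
        C * min 1 (‖h‖ * r ^ (-3 : ℤ)) := by
  obtain ⟨C₁, hC₁, H₁⟩ := hψ.exists_integral_Kker_le
  obtain ⟨C₂, hC₂, H₂⟩ := hψ.exists_integral_Kpi_le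
  obtain ⟨C₃, hC₃, H₃⟩ := hψ.exists_integral_Kvec_le
  refine ⟨C₁ + C₂ + C₃ + 1, by positivity, fun r hr h => ?_⟩
  have hmin : 0 ≤ min 1 (‖h‖ * r ^ (-3 : ℤ)) := le_min zero_le_one (by positivity)
  linarith [H₁ r hr h, H₂ r hr h, H₃ r hr h]
end
end

section
/- (Lemma 2.5: commutation of the fractional x-derivative with kinetic convolution.) Let J, f ∈ 𝒮(ℝ^{1+2d}). Then for every z = (t,x,v) ∈ ℝ^{1+2d}, the absolutely convergent integrals satisfy ∫_{ℝ^d} (2[T_J f](t,x,v) − [T_J f](t,x+h,v) − [T_J f](t,x−h,v)) |h|^{−d−1/3} dh = [T_{J°} f](z), where J°(s,y,w) = ∫_{ℝ^d} (2J(s,y,w) − J(s,y+h,w) − J(s,y−h,w)) |h|^{−d−1/3} dh; that is, 𝔇_x (T_J f) = T_{𝔇_y J} f, where 𝔇_y acts on kernels in the spatial kernel variable y by the same singular integral. -/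
open MeasureTheory Real ENNReal
open scoped RealInnerProductSpace

noncomputable section

/-- The (unnormalised) fractional derivative of order `1/3` in the second (spatial)
variable: `[𝔇_x u](t,x,v) = ∫ (2u(t,x,v) − u(t,x+h,v) − u(t,x−h,v)) |h|^{−d−1/3} dh`.
Applied to a kernel `J(s,y,w)` this is the operator `𝔇_y` acting in the `y` variable. -/
def fracDx {d : ℕ} (u : Pt d → ℝ) (z : Pt d) : ℝ :=
  ∫ h : V d, (2 * u z - u (z.1, z.2.1 + h, z.2.2) - u (z.1, z.2.1 - h, z.2.2)) *
    ‖h‖ ^ (-(d : ℝ) - 1 / 3)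
/-- The truncated linear weight `min(a, b|h|) |h|^{-d-1/3}` is integrable on `ℝ^d`. -/
theorem integrable_min_mul_norm_rpow {d : ℕ} (hd : 1 ≤ d) {a b : ℝ} (ha : 0 ≤ a) (hb : 0 ≤ b) :
    Integrable fun h : V d => min a (b * ‖h‖) * ‖h‖ ^ (-(d : ℝ) - 1 / 3) := by
  have : Nonempty (Fin d) := ⟨⟨0, hd⟩⟩
  have key := integrable_fun_norm_addHaar (volume : Measure (V d))
    (f := fun r : ℝ => min a (b * r) * r ^ (-(d : ℝ) - 1 / 3))
  rw [key, finrank_euclideanSpace_fin]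
  have hpow : ∀ y : ℝ, 0 < y →
      y ^ (d - 1) • (min a (b * y) * y ^ (-(d : ℝ) - 1 / 3)) =
        min a (b * y) * y ^ (-(4 / 3) : ℝ) := by
    intro y hy
    have : y ^ (d - 1) * y ^ (-(d : ℝ) - 1 / 3) = y ^ (-(4 / 3) : ℝ) := by
      rw [← Real.rpow_natCast, ← Real.rpow_add hy, Nat.cast_sub hd]
      congr 1
      push_cast
      ring
    rw [smul_eq_mul, ← this]
    ring
  rw [integrableOn_congr_fun (s := Set.Ioi 0) (fun y hy => hpow y hy) measurableSet_Ioi,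
    ← Set.Ioc_union_Ioi_eq_Ioi (zero_le_one' ℝ)]
  have hmeas : ∀ μ : Measure ℝ,
      AEStronglyMeasurable (fun y : ℝ => min a (b * y) * y ^ (-(4 / 3) : ℝ)) μ :=
    fun μ => Measurable.aestronglyMeasurable (by fun_prop)
  refine IntegrableOn.union ?_ ?_
  · have h0 : IntegrableOn (fun y : ℝ => b * y ^ (-(1 / 3) : ℝ)) (Set.Ioc 0 1) :=
      ((intervalIntegrable_iff_integrableOn_Ioc_of_le zero_le_one).1
        (intervalIntegral.intervalIntegrable_rpow' (by norm_num))).const_mul b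
    refine h0.mono' (hmeas _) ((ae_restrict_iff' measurableSet_Ioc).2 (.of_forall fun y hy => ?_))
    have hy0 : 0 < y := hy.1
    rw [Real.norm_of_nonneg (by positivity)]
    have : y * y ^ (-(4 / 3) : ℝ) = y ^ (-(1 / 3) : ℝ) := by
      rw [← Real.rpow_one_add' hy0.le (by norm_num)]
      norm_num
    calc _ ≤ (b * y) * y ^ (-(4 / 3) : ℝ) := by gcongr; exact min_le_right _ _
      _ = _ := by rw [mul_assoc, this]
  · have h1 : IntegrableOn (fun y : ℝ => a * y ^ (-(4 / 3) : ℝ)) (Set.Ioi 1) :=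
      (integrableOn_Ioi_rpow_of_lt (by norm_num) one_pos).const_mul a
    refine h1.mono' (hmeas _) ((ae_restrict_iff' measurableSet_Ioi).2 (.of_forall fun y hy => ?_))
    have hy0 : 0 < y := one_pos.trans hy
    rw [Real.norm_of_nonneg (by positivity)]
    gcongr
    exact min_le_left _ _

/-- A Schwartz function is bounded and Lipschitz, so its symmetric second differences are
controlled by a truncated linear function of the increment. -/
theorem SchwartzMap.exists_abs_second_difference_le {E : Type*} [NormedAddCommGroup E]
    [NormedSpace ℝ E] (J : SchwartzMap E ℝ) :
    ∃ a b : ℝ, 0 ≤ a ∧ 0 ≤ b ∧ (∀ m, |J m| ≤ a) ∧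
      ∀ m e : E, |2 * J m - J (m + e) - J (m - e)| ≤ min (4 * a) (b * ‖e‖) := by
  obtain ⟨a, ha0, ha⟩ := J.decay 0 0
  obtain ⟨b, hb0, hb⟩ := J.decay 0 1
  have ha' : ∀ m, |J m| ≤ a := fun m => by simpa using ha m
  have hL : ∀ p q : E, |J q - J p| ≤ b * ‖q - p‖ := fun p q =>
    Convex.norm_image_sub_le_of_norm_fderiv_le (𝕜 := ℝ) (s := Set.univ)
      (fun x _ => J.differentiableAt)
      (fun x _ => by simpa [norm_iteratedFDeriv_one] using hb x) convex_univ trivial trivial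
  refine ⟨a, 2 * b, ha0.le, by positivity, ha', fun m e => le_min ?_ ?_⟩
  · have h0 := abs_le.1 (ha' m)
    have h1 := abs_le.1 (ha' (m + e))
    have h2 := abs_le.1 (ha' (m - e))
    rw [abs_le]
    constructor <;> linarith
  · have h1 := hL m (m + e)
    have h2 := hL m (m - e)
    rw [add_sub_cancel_left] at h1
    rw [sub_sub_cancel_left, norm_neg] at h2
    rw [abs_le] at *
    constructor <;> linarith

theorem kmul_kinv_translate {d : ℕ} (z m : Pt d) (h : V d) :
    kmul (kinv (z.1, z.2.1 + h, z.2.2)) m = kmul (kinv z) m - (0, h, 0) := by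
  ext1
  · simp [kmul, kinv]
  ext1
  · simp only [kmul, kinv, Prod.snd_sub, Prod.fst_sub]
    abel
  · simp [kmul, kinv]

theorem continuous_kmul_left {d : ℕ} (z : Pt d) : Continuous (kmul z) := by
  unfold kmul
  fun_prop

/-- **Lemma 2.5: commutation of the fractional `x`-derivative with kinetic convolution.**
For Schwartz `J, f` and every `z`, the defining singular integrals converge absolutely and
`𝔇_x (T_J f) = T_{𝔇_y J} f` at `z`. -/
theorem statement12 (d : ℕ) (hd : 1 ≤ d)
    (J f : SchwartzMap (Pt d) ℝ) (z : Pt d) :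
    (Integrable fun h : V d =>
      (2 * Tsc (⇑J) (⇑f) z - Tsc (⇑J) (⇑f) (z.1, z.2.1 + h, z.2.2) -
        Tsc (⇑J) (⇑f) (z.1, z.2.1 - h, z.2.2)) * ‖h‖ ^ (-(d : ℝ) - 1 / 3)) ∧
    (∀ m : Pt d, Integrable fun h : V d =>
      (2 * J m - J (m.1, m.2.1 + h, m.2.2) - J (m.1, m.2.1 - h, m.2.2)) *
        ‖h‖ ^ (-(d : ℝ) - 1 / 3)) ∧
    fracDx (Tsc (⇑J) (⇑f)) z = Tsc (fracDx (⇑J)) (⇑f) z := by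
  obtain ⟨a, b, ha, hb, hJa, hJ⟩ := J.exists_abs_second_difference_le
  have hw := integrable_min_mul_norm_rpow hd (mul_nonneg zero_le_four ha) hb
  have : (volume : Measure (V d × V d)).IsAddHaarMeasure :=
    Measure.prod.instIsAddHaarMeasure volume volume
  have : (volume : Measure (Pt d)).IsAddHaarMeasure :=
    Measure.prod.instIsAddHaarMeasure volume volume
  have hf : Integrable (⇑f) := f.integrable
  have hcont := continuous_kmul_left (kinv z)
  have hadd : ∀ (m : Pt d) (h : V d), (m.1, m.2.1 + h, m.2.2) = m + (0, h, 0) :=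
    fun m h => by ext1 <;> simp [Prod.ext_iff]
  have hsub : ∀ (m : Pt d) (h : V d), (m.1, m.2.1 - h, m.2.2) = m - (0, h, 0) :=
    fun m h => by ext1 <;> simp [Prod.ext_iff]
  have hbound : ∀ (m : Pt d) (h : V d),
      ‖(2 * J m - J (m.1, m.2.1 + h, m.2.2) - J (m.1, m.2.1 - h, m.2.2)) *
        ‖h‖ ^ (-(d : ℝ) - 1 / 3)‖ ≤
      min (4 * a) (b * ‖h‖) * ‖h‖ ^ (-(d : ℝ) - 1 / 3) := by
    intro m h
    rw [norm_mul, Real.norm_of_nonneg (by positivity : 0 ≤ ‖h‖ ^ (-(d : ℝ) - 1 / 3)), hadd, hsub]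
    gcongr
    simpa [Prod.norm_def] using hJ m (0, h, 0)
  let F : V d × Pt d → ℝ := fun p =>
    (2 * J (kmul (kinv z) p.2) -
      J ((kmul (kinv z) p.2).1, (kmul (kinv z) p.2).2.1 + p.1, (kmul (kinv z) p.2).2.2) -
      J ((kmul (kinv z) p.2).1, (kmul (kinv z) p.2).2.1 - p.1, (kmul (kinv z) p.2).2.2)) *
      ‖p.1‖ ^ (-(d : ℝ) - 1 / 3) * f p.2
  have hF : Integrable F (volume.prod volume) := by
    refine (hw.mul_prod hf.norm).mono' ?_ (.of_forall fun p => ?_)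
    · have hJc := J.continuous
      have hfc := f.continuous
      refine Measurable.aestronglyMeasurable (.mul (.mul ?_ (by fun_prop)) ?_)
      · exact Continuous.measurable (by fun_prop)
      · exact Continuous.measurable (by fun_prop)
    · rw [norm_mul]
      gcongr
      exact hbound _ _
  have hTint : ∀ e : Pt d, Integrable fun m => J (kmul (kinv z) m + e) * f m := fun e =>
    hf.bdd_mul (c := a) (J.continuous.comp (by fun_prop)).aestronglyMeasurable
      (.of_forall fun m => hJa _)
  have hT : ∀ h : V d,
      (2 * Tsc (⇑J) (⇑f) z - Tsc (⇑J) (⇑f) (z.1, z.2.1 + h, z.2.2) -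
        Tsc (⇑J) (⇑f) (z.1, z.2.1 - h, z.2.2)) * ‖h‖ ^ (-(d : ℝ) - 1 / 3) =
      ∫ m, F (h, m) := by
    intro h
    have i0 : Integrable fun m => 2 * (J (kmul (kinv z) m) * f m) := by
      simpa using (hTint 0).const_mul 2
    have i1 : Integrable fun m => J (kmul (kinv z) m - (0, h, 0)) * f m := by
      simpa only [sub_eq_add_neg] using hTint (-(0, h, 0))
    have i2 : Integrable fun m => J (kmul (kinv z) m + (0, h, 0)) * f m := hTint (0, h, 0)
    have hneg : ∀ m, kmul (kinv (z.1, z.2.1 - h, z.2.2)) m = kmul (kinv z) m + (0, h, 0) := by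
      intro m
      rw [sub_eq_add_neg, kmul_kinv_translate, sub_eq_add_neg]
      simp
    simp only [Tsc, kmul_kinv_translate, hneg]
    simp only [F, hadd, hsub]
    rw [← integral_const_mul, ← integral_sub i0 i1, ← integral_sub (by exact i0.sub i1) i2,
      ← integral_mul_const]
    refine integral_congr_ae (.of_forall fun m => ?_)
    ring
  refine ⟨?_, fun m => ?_, ?_⟩
  · simp only [hT]
    exact hF.integral_prod_left
  · refine hw.mono' ?_ (.of_forall (hbound m))
    have hJc := J.continuous
    refine Measurable.aestronglyMeasurable (.mul ?_ (by fun_prop))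
    exact Continuous.measurable (by fun_prop)
  · rw [fracDx]
    simp only [hT]
    rw [integral_integral_swap hF]
    refine integral_congr_ae (.of_forall fun m => ?_)
    simp only [F, fracDx]
    rw [integral_mul_const]
end
end

section
/- (Theorem 3.1: transfer of regularity in Hörmander's Besov scale.) Let p ∈ [Q/(Q−1), ∞] and define q ∈ [1,∞] by 1/q = 1/p + 1/Q. There exists a constant C = C(d,p) > 0 such that for every f ∈ 𝒮(ℝ^{1+2d}) satisfying (∂_t + v·∇_x) f = ∇_v · S_0 + S_1 pointwise on ℝ^{1+2d}, with S_0 ∈ 𝒮(ℝ^{1+2d}; ℝ^d) and S_1 ∈ 𝒮(ℝ^{1+2d}), one has sup_{h ∈ ℝ^d, h ≠ 0} |h|^{−1/3} ‖Δ_x^h f‖_{L^p(ℝ^{1+2d})} ≤ C ( ‖S_0‖_{L^p(ℝ^{1+2d})} + ‖∇_v f‖_{L^p(ℝ^{1+2d})} + ‖S_1‖_{L^q(ℝ^{1+2d})} ). -/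
open MeasureTheory Real ENNReal
open scoped RealInnerProductSpace

noncomputable section

section Minkowski

variable {α Ω : Type*} [MeasurableSpace α] [MeasurableSpace Ω] {μ : Measure α} {ν : Measure Ω}

lemma lintegral_rpow_le_measure_univ_mul {g : Ω → ℝ≥0∞} (hg : Measurable g) {r : ℝ} (hr : 1 ≤ r) :
    (∫⁻ ω, g ω ∂ν) ^ r ≤ ν Set.univ ^ (r - 1) * ∫⁻ ω, g ω ^ r ∂ν := by
  have hr0 : 0 < r := by linarith
  have h := eLpNorm_le_eLpNorm_mul_rpow_measure_univ (μ := ν) (f := g) (p := 1)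
    (q := ENNReal.ofReal r) (by simpa using ENNReal.ofReal_le_ofReal hr)
    hg.aestronglyMeasurable
  rw [eLpNorm_one_eq_lintegral_enorm, eLpNorm_eq_lintegral_rpow_enorm_toReal (by simpa using hr0)
    (by simp), ENNReal.toReal_ofReal hr0.le] at h
  simp only [enorm_eq_self, ENNReal.toReal_one] at h
  calc _ ≤ _ := ENNReal.rpow_le_rpow h hr0.le
    _ = _ := by
      rw [ENNReal.mul_rpow_of_nonneg _ _ hr0.le, ← ENNReal.rpow_mul, ← ENNReal.rpow_mul, mul_comm]
      congr 2
      · field_simp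
      · field_simp; simp

/-- Minkowski's integral inequality for a finite measure and a uniform bound on the slices. -/
lemma eLpNorm_lintegral_le [SFinite μ] [IsFiniteMeasure ν] {p : ℝ≥0∞} (hp : 1 ≤ p)
    {G : α → Ω → ℝ≥0∞} (hG : Measurable (Function.uncurry G)) {B : ℝ≥0∞}
    (hB : ∀ᵐ ω ∂ν, eLpNorm (fun z => G z ω) p μ ≤ B) :
    eLpNorm (fun z => ∫⁻ ω, G z ω ∂ν) p μ ≤ ν Set.univ * B := by
  rcases eq_or_ne p ⊤ with rfl | hpt
  · simp only [eLpNorm_exponent_top] at hB ⊢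
    have h1 : ∀ᵐ ω ∂ν, ∀ᵐ z ∂μ, G z ω ≤ B := by
      filter_upwards [hB] with ω hω
      filter_upwards [ae_le_eLpNormEssSup (f := fun z => G z ω) (μ := μ)] with z hz
      exact le_trans (by simpa using hz) hω
    have h2 : ∀ᵐ z ∂μ, ∀ᵐ ω ∂ν, G z ω ≤ B := by
      refine (Measure.ae_ae_comm (p := fun z ω => G z ω ≤ B) ?_).2 h1
      exact measurableSet_le hG measurable_const
    refine essSup_le_of_ae_le _ ?_
    filter_upwards [h2] with z hz
    simp only [enorm_eq_self]
    calc _ ≤ ∫⁻ _, B ∂ν := lintegral_mono_ae hz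
      _ = _ := by simp [mul_comm]
  · have hp0 : p ≠ 0 := by positivity
    set r := p.toReal
    have hr : 1 ≤ r := by simpa using ENNReal.toReal_mono hpt hp
    have hr0 : 0 < r := by linarith
    have hB' : ∀ᵐ ω ∂ν, ∫⁻ z, G z ω ^ r ∂μ ≤ B ^ r := by
      filter_upwards [hB] with ω hω
      rw [eLpNorm_eq_lintegral_rpow_enorm_toReal hp0 hpt] at hω
      simp only [enorm_eq_self, one_div] at hω
      exact (ENNReal.rpow_inv_le_iff hr0).1 hω
    rw [eLpNorm_eq_lintegral_rpow_enorm_toReal hp0 hpt]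
    simp only [enorm_eq_self, one_div]
    rw [ENNReal.rpow_inv_le_iff hr0]
    calc ∫⁻ z, (∫⁻ ω, G z ω ∂ν) ^ r ∂μ
        ≤ ∫⁻ z, ν Set.univ ^ (r - 1) * ∫⁻ ω, G z ω ^ r ∂ν ∂μ :=
          lintegral_mono fun z =>
            lintegral_rpow_le_measure_univ_mul (hG.comp measurable_prodMk_left) hr
      _ = ν Set.univ ^ (r - 1) * ∫⁻ ω, ∫⁻ z, G z ω ^ r ∂μ ∂ν := by
          rw [lintegral_const_mul' _ _ (ENNReal.rpow_ne_top_of_nonneg (by linarith) (by simp)),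
            lintegral_lintegral_swap (hG.pow_const r).aemeasurable]
      _ ≤ ν Set.univ ^ (r - 1) * ∫⁻ _, B ^ r ∂ν := by
          exact mul_le_mul_right (lintegral_mono_ae hB') _
      _ = _ := by
          rw [lintegral_const, ENNReal.mul_rpow_of_nonneg _ _ hr0.le, mul_comm (B ^ r), ← mul_assoc]
          congr 1
          nth_rw 2 [← ENNReal.rpow_one (ν Set.univ)]
          rw [← ENNReal.rpow_add_of_nonneg _ _ (by linarith) zero_le_one, sub_add_cancel]

lemma eLpNorm_lintegral_mul_le [SFinite μ] [SFinite ν] {p : ℝ≥0∞} (hp : 1 ≤ p)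
    {G : α → Ω → ℝ≥0∞} (hG : Measurable (Function.uncurry G)) {k : Ω → ℝ≥0∞} (hk : Measurable k)
    (hk' : ∫⁻ ω, k ω ∂ν ≠ ∞) {B : ℝ≥0∞}
    (hB : ∀ ω, k ω ≠ 0 → eLpNorm (fun z => G z ω) p μ ≤ B) :
    eLpNorm (fun z => ∫⁻ ω, k ω * G z ω ∂ν) p μ ≤ (∫⁻ ω, k ω ∂ν) * B := by
  have := isFiniteMeasure_withDensity hk'
  have h := eLpNorm_lintegral_le (ν := ν.withDensity k) (μ := μ) hp hG (B := B)
    ((ae_withDensity_iff hk).2 (ae_of_all _ hB))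
  rw [withDensity_apply _ MeasurableSet.univ, Measure.restrict_univ] at h
  refine le_trans (le_of_eq ?_) h
  congr 1
  ext z
  have hGz : Measurable (G z) := hG.comp measurable_prodMk_left
  rw [lintegral_withDensity_eq_lintegral_mul _ hk hGz]
  rfl

lemma eLpNorm_le_of_le_of_eLpNorm_le {p q : ℝ≥0∞} (hq : 1 ≤ q) (hqp : q ≤ p)
    {g : α → ℝ≥0∞} {X : ℝ≥0∞} (hX : ∀ z, g z ≤ X) (hg : eLpNorm g q μ ≤ X) :
    eLpNorm g p μ ≤ X := by
  rcases eq_or_ne p ⊤ with rfl | hpt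
  · rw [eLpNorm_exponent_top]
    exact essSup_le_of_ae_le _ (ae_of_all _ fun z => by simpa using hX z)
  have hqt : q ≠ ⊤ := ne_top_of_le_ne_top hpt hqp
  have hq0 : q ≠ 0 := by positivity
  have hp0 : p ≠ 0 := by rintro rfl; simp_all
  have h1 : q.toReal ≤ p.toReal := ENNReal.toReal_mono hpt hqp
  have hq1 : 0 < q.toReal := ENNReal.toReal_pos hq0 hqt
  have hp1 : 0 < p.toReal := ENNReal.toReal_pos hp0 hpt
  rw [eLpNorm_eq_lintegral_rpow_enorm_toReal hq0 hqt, one_div, ENNReal.rpow_inv_le_iff hq1] at hg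
  rw [eLpNorm_eq_lintegral_rpow_enorm_toReal hp0 hpt, one_div, ENNReal.rpow_inv_le_iff hp1]
  simp only [enorm_eq_self] at *
  rcases eq_or_ne X ⊤ with rfl | hXt
  · simp [hp1]
  calc ∫⁻ z, g z ^ p.toReal ∂μ ≤ ∫⁻ z, X ^ (p.toReal - q.toReal) * g z ^ q.toReal ∂μ := by
        refine lintegral_mono fun z => ?_
        calc g z ^ p.toReal = g z ^ (p.toReal - q.toReal) * g z ^ q.toReal := by
              rw [← ENNReal.rpow_add_of_nonneg _ _ (by linarith) hq1.le, sub_add_cancel]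
          _ ≤ _ := by
              gcongr
              exact hX z
    _ = X ^ (p.toReal - q.toReal) * ∫⁻ z, g z ^ q.toReal ∂μ :=
        lintegral_const_mul' _ _ (ENNReal.rpow_ne_top_of_nonneg (by linarith) hXt)
    _ ≤ X ^ (p.toReal - q.toReal) * X ^ q.toReal := by gcongr
    _ = _ := by rw [← ENNReal.rpow_add_of_nonneg _ _ (by linarith) hq1.le, sub_add_cancel]

/-- A Young-type inequality for averages of a function along a family of transformations. -/
lemma eLpNorm_lintegral_mul_le_of_le [SFinite μ] [SFinite ν] {p q : ℝ≥0∞} (hq : 1 ≤ q)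
    (hqp : q ≤ p) (hqt : q ≠ ∞)
    {G : α → Ω → ℝ≥0∞} (hG : Measurable (Function.uncurry G)) {k : Ω → ℝ≥0∞} (hk : Measurable k)
    (hk' : ∫⁻ ω, k ω ∂ν ≤ 1) {K : ℝ≥0∞} (hK1 : 1 ≤ K) (hkK : ∀ ω, k ω ≤ K) {A : ℝ≥0∞}
    (hA : ∀ ω, eLpNorm (fun z => G z ω) q μ ≤ A) (hA' : ∀ z, eLpNorm (G z) q ν ≤ A) :
    eLpNorm (fun z => ∫⁻ ω, k ω * G z ω ∂ν) p μ ≤ K * A := by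
  have hq0 : q ≠ 0 := by positivity
  have hq1 : 1 ≤ q.toReal := by simpa using ENNReal.toReal_mono hqt hq
  have hq2 : 0 < q.toReal := by linarith
  refine eLpNorm_le_of_le_of_eLpNorm_le hq hqp (fun z => ?_) ?_
  · have := hA' z
    rw [eLpNorm_eq_lintegral_rpow_enorm_toReal hq0 hqt, one_div, ENNReal.rpow_inv_le_iff hq2]
      at this
    simp only [enorm_eq_self] at this
    rw [← ENNReal.rpow_le_rpow_iff hq2]
    have hGz : Measurable (G z) := hG.comp measurable_prodMk_left
    have h := lintegral_rpow_le_measure_univ_mul (ν := ν.withDensity k) hGz hq1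
    rw [withDensity_apply _ MeasurableSet.univ, Measure.restrict_univ,
      lintegral_withDensity_eq_lintegral_mul _ hk hGz,
      lintegral_withDensity_eq_lintegral_mul _ hk (hGz.pow_const _)] at h
    simp only [Pi.mul_apply] at h
    refine h.trans ?_
    calc _ ≤ 1 * ∫⁻ ω, K * G z ω ^ q.toReal ∂ν := by
          gcongr
          · exact ENNReal.rpow_le_one hk' (by linarith)
          · exact hkK _
      _ = K * ∫⁻ ω, G z ω ^ q.toReal ∂ν := by rw [one_mul, lintegral_const_mul _ (hGz.pow_const _)]
      _ ≤ K ^ q.toReal * A ^ q.toReal := by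
          gcongr
          simpa using ENNReal.rpow_le_rpow_of_exponent_le hK1 hq1
      _ = _ := (ENNReal.mul_rpow_of_nonneg _ _ hq2.le).symm
  · refine (eLpNorm_lintegral_mul_le hq hG hk (ne_top_of_le_ne_top (by simp) hk')
      (fun ω _ => hA ω)).trans ?_
    gcongr
    exact hk'.trans hK1

end Minkowski

section Kinetic

variable {d : ℕ}

instance isAddHaarMeasure_volume_prod : (volume : Measure (V d × V d)).IsAddHaarMeasure :=
  Measure.prod.instIsAddHaarMeasure (volume : Measure (V d)) (volume : Measure (V d))

instance isAddHaarMeasure_volume_Pt : (volume : Measure (Pt d)).IsAddHaarMeasure :=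
  Measure.prod.instIsAddHaarMeasure (volume : Measure ℝ) (volume : Measure (V d × V d))

lemma continuous_kmul : Continuous fun a : Pt d × Pt d => kmul a.1 a.2 := by
  unfold kmul; fun_prop

lemma measurePreserving_kmul_left (z : Pt d) : MeasurePreserving (fun m : Pt d => kmul z m) := by
  refine (measurePreserving_add_left volume z.1).skew_product
    (g := fun (s : ℝ) (q : V d × V d) => (z.2.1 + q.1 + s • z.2.2, z.2.2 + q.2)) ?_ ?_
  · apply Continuous.measurable; fun_prop
  · refine ae_of_all _ fun s => ?_
    have h := measurePreserving_add_left (volume : Measure (V d × V d)) (z.2.1 + s • z.2.2, z.2.2)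
    convert! h.map_eq using 2
    ext1 q
    simp only [Prod.ext_iff, Prod.fst_add, Prod.snd_add, and_true]
    abel

lemma measurePreserving_shear (s : ℝ) :
    MeasurePreserving (fun q : V d × V d => (q.1 + s • q.2, q.2)) := by
  have h : MeasurePreserving (fun q : V d × V d => (q.1, q.2 + s • q.1)) := by
    refine (MeasurePreserving.id volume).skew_product
      (g := fun (a : V d) (b : V d) => b + s • a) ?_ ?_
    · apply Continuous.measurable; fun_prop
    · exact ae_of_all _ fun a => (measurePreserving_add_right volume (s • a)).map_eq
  exact (Measure.measurePreserving_swap.comp h).comp Measure.measurePreserving_swap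

lemma measurePreserving_kmul_right (m : Pt d) : MeasurePreserving (fun z : Pt d => kmul z m) := by
  have h := (measurePreserving_add_right (volume : Measure (Pt d)) m).comp
    ((MeasurePreserving.id (volume : Measure ℝ)).prod (measurePreserving_shear (d := d) m.1))
  convert! h using 1
  ext1 z
  simp only [kmul, Function.comp, Prod.map, Prod.ext_iff, Prod.fst_add, Prod.snd_add, and_true,
    id, true_and]
  abel

/-- Lebesgue measure on `(0, 1] × ℝ^d × ℝ^d`. -/
def slab (d : ℕ) : Measure (Pt d) := (volume.restrict (Set.Ioc (0 : ℝ) 1)).prod volume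

instance : SFinite (slab d) := by unfold slab; infer_instance

lemma slab_le : slab d ≤ volume := by
  unfold slab
  exact Measure.prod_mono Measure.restrict_le_self le_rfl

lemma eLpNorm_sub_comp_add_le {p : ℝ≥0∞} (hp : 1 ≤ p) {g : Pt d → ℝ} (hg : ContDiff ℝ 1 g)
    (e : Pt d) :
    eLpNorm (fun z => g (z + e) - g z) p volume ≤ eLpNorm (fun z => fderiv ℝ g z e) p volume := by
  have hc : Continuous fun z => fderiv ℝ g z e := (hg.continuous_fderiv one_ne_zero).clm_apply
    continuous_const
  have h1 : ∀ z, g (z + e) - g z = ∫ θ in (0 : ℝ)..1, fderiv ℝ g (z + θ • e) e := by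
    intro z
    rw [intervalIntegral.integral_eq_sub_of_hasDerivAt (f := fun θ : ℝ => g (z + θ • e))]
    · simp
    · intro θ _
      have h2 : HasDerivAt (fun θ : ℝ => z + θ • e) e θ := by
        simpa using ((hasDerivAt_id θ).smul_const e).const_add z
      exact ((hg.differentiable one_ne_zero _).hasFDerivAt).comp_hasDerivAt θ h2
    · apply Continuous.intervalIntegrable
      fun_prop
  let G : Pt d → ℝ → ℝ≥0∞ := fun z θ => ‖fderiv ℝ g (z + θ • e) e‖ₑ
  have hG : Measurable (Function.uncurry G) := by
    have : Continuous fun a : Pt d × ℝ => fderiv ℝ g (a.1 + a.2 • e) e := by fun_prop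
    exact this.measurable.enorm
  calc _ ≤ eLpNorm (fun z => ∫⁻ θ in Set.Ioc (0 : ℝ) 1, G z θ) p volume := by
        refine eLpNorm_mono_enorm fun z => ?_
        rw [h1, intervalIntegral.integral_of_le zero_le_one, enorm_eq_self]
        exact enorm_integral_le_lintegral_enorm _
    _ ≤ (volume.restrict (Set.Ioc (0 : ℝ) 1)) Set.univ *
          eLpNorm (fun z => fderiv ℝ g z e) p volume := by
        refine eLpNorm_lintegral_le hp hG (ae_of_all _ fun θ => ?_)
        simp only [G]
        rw [eLpNorm_enorm (fun z => fderiv ℝ g (z + θ • e) e)]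
        exact (eLpNorm_comp_measurePreserving (p := p) hc.aestronglyMeasurable
          (measurePreserving_add_right (volume : Measure (Pt d)) (θ • e))).le
    _ = _ := by simp

lemma fderiv_velocity_eq_inner (g : Pt d → ℝ) (z : Pt d) (w : V d) :
    fderiv ℝ g z (0, 0, w) = ∑ i, gradV g z i * w i := by
  have hw : w = ∑ i, w i • EuclideanSpace.single i (1 : ℝ) := by
    ext j
    simp [Finset.sum_apply, Pi.single_apply]
  have h2 : ((0, 0, w) : Pt d)
      = ∑ i, w i • ((0, 0, EuclideanSpace.single i (1 : ℝ)) : Pt d) := by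
    conv_lhs => rw [hw]
    ext <;> simp [Prod.fst_sum, Prod.snd_sum]
  rw [h2, map_sum]
  refine Finset.sum_congr rfl fun i _ => ?_
  rw [map_smul, smul_eq_mul, mul_comm]
  rfl

lemma abs_fderiv_velocity_le (g : Pt d → ℝ) (z : Pt d) (w : V d) :
    ‖fderiv ℝ g z (0, 0, w)‖ ≤ ‖w‖ * ‖gradV g z‖ := by
  have : fderiv ℝ g z (0, 0, w) = ⟪w, gradV g z⟫ := by
    rw [fderiv_velocity_eq_inner, PiLp.inner_apply]
    simp
  rw [this]
  exact norm_inner_le_norm _ _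

lemma eLpNorm_velocity_shift_le {p : ℝ≥0∞} (hp : 1 ≤ p) {g : Pt d → ℝ} (hg : ContDiff ℝ 1 g)
    (w : V d) :
    eLpNorm (fun z : Pt d => g (z.1, z.2.1, z.2.2 + w) - g z) p volume ≤
      ENNReal.ofReal ‖w‖ * eLpNorm (gradV g) p volume := by
  have h := eLpNorm_sub_comp_add_le hp hg ((0, 0, w) : Pt d)
  have h2 : (fun z : Pt d => g (z.1, z.2.1, z.2.2 + w) - g z)
      = fun z : Pt d => g (z + (0, 0, w)) - g z := by
    ext z
    congr 2
    ext <;> simp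
  rw [h2]
  refine h.trans ?_
  exact eLpNorm_le_mul_eLpNorm_of_ae_le_mul (ae_of_all _ fun z => abs_fderiv_velocity_le g z w) p

/-- A nonnegative `C¹` function of integral one, supported in the ball of radius `ρ`. -/
structure IsMollifier (β : V d → ℝ) (ρ : ℝ) : Prop where
  contDiff : ContDiff ℝ 1 β
  nonneg : ∀ y, 0 ≤ β y
  integral_eq_one : ∫ y, β y = 1
  norm_le : ∀ y ∈ tsupport β, ‖y‖ ≤ ρ

namespace IsMollifier

variable {β : V d → ℝ} {ρ : ℝ}

lemma exists_of_pos (hρ : 0 < ρ) : ∃ β : V d → ℝ, IsMollifier β ρ := by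
  let b : ContDiffBump (0 : V d) := ⟨ρ / 2, ρ, by positivity, by linarith⟩
  refine ⟨b.normed volume, b.contDiff_normed, b.nonneg_normed, b.integral_normed, ?_⟩
  intro y hy
  rw [b.tsupport_normed_eq] at hy
  simpa using hy

lemma hasCompactSupport (hβ : IsMollifier β ρ) : HasCompactSupport β :=
  HasCompactSupport.of_support_subset_isCompact (isCompact_closedBall (0 : V d) ρ)
    fun y hy => by simpa using hβ.norm_le y (subset_tsupport _ hy)

lemma continuous_fderiv (hβ : IsMollifier β ρ) : Continuous (fderiv ℝ β) :=
  hβ.contDiff.continuous_fderiv one_ne_zero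

lemma norm_le_of_ne_zero (hβ : IsMollifier β ρ) {y : V d} (hy : β y ≠ 0) : ‖y‖ ≤ ρ :=
  hβ.norm_le y (subset_tsupport _ hy)

lemma norm_le_of_fderiv_ne_zero (hβ : IsMollifier β ρ) {y : V d} (hy : fderiv ℝ β y ≠ 0) :
    ‖y‖ ≤ ρ :=
  hβ.norm_le y (support_fderiv_subset ℝ hy)

lemma integral_mul_fderiv (hβ : IsMollifier β ρ) {g : V d → ℝ} (hg : ContDiff ℝ 1 g) (e : V d) :
    ∫ y, β y * fderiv ℝ g y e = - ∫ y, fderiv ℝ β y e * g y := by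
  have hβc := hβ.hasCompactSupport
  have h1 := hβ.continuous_fderiv
  have h2 := hg.continuous_fderiv one_ne_zero
  have h3 := hg.continuous
  have h4 := hβ.contDiff.continuous
  refine integral_mul_fderiv_eq_neg_fderiv_mul_of_integrable ?_ ?_ ?_ ?_ ?_
  · exact Continuous.integrable_of_hasCompactSupport (by fun_prop)
      ((hβc.fderiv_apply ℝ e).mul_right)
  · exact Continuous.integrable_of_hasCompactSupport (by fun_prop) hβc.mul_right
  · exact Continuous.integrable_of_hasCompactSupport (by fun_prop) hβc.mul_right
  · exact fun y _ => hβ.contDiff.differentiable one_ne_zero y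
  · exact fun y _ => hg.differentiable one_ne_zero y

lemma lintegral_ofReal (hβ : IsMollifier β ρ) : ∫⁻ y, ENNReal.ofReal (β y) = 1 := by
  rw [← ofReal_integral_eq_lintegral_ofReal _ (ae_of_all _ hβ.nonneg), hβ.integral_eq_one]
  · simp
  · exact hβ.contDiff.continuous.integrable_of_hasCompactSupport hβ.hasCompactSupport

lemma lintegral_enorm_fderiv_ne_top (hβ : IsMollifier β ρ) : ∫⁻ y, ‖fderiv ℝ β y‖ₑ ≠ ∞ :=
  (hβ.continuous_fderiv.integrable_of_hasCompactSupport (hβ.hasCompactSupport.fderiv ℝ)).2.ne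

end IsMollifier

lemma integrable_slab {F : Pt d → ℝ} (hF : Continuous F) {R : ℝ}
    (hR : ∀ ω, F ω ≠ 0 → ‖ω.2.1‖ ≤ R ∧ ‖ω.2.2‖ ≤ R) : Integrable F (slab d) := by
  have h : slab d = volume.restrict (Set.Ioc (0 : ℝ) 1 ×ˢ Set.univ) := by
    unfold slab
    rw [Measure.volume_eq_prod ℝ (V d × V d), ← Measure.prod_restrict, Measure.restrict_univ]
  let K : Set (Pt d) := Set.Icc 0 1 ×ˢ (Metric.closedBall 0 R ×ˢ Metric.closedBall 0 R)
  have hK : IsCompact K :=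
    isCompact_Icc.prod ((isCompact_closedBall _ _).prod (isCompact_closedBall _ _))
  have h1 : IntegrableOn F K volume := hF.continuousOn.integrableOn_compact hK
  rw [h]
  refine IntegrableOn.of_forall_sdiff_eq_zero h1 (by measurability) ?_
  rintro ω ⟨⟨hω, -⟩, hωK⟩
  by_contra hne
  exact hωK ⟨Set.Ioc_subset_Icc_self hω, by simpa using (hR ω hne).1, by simpa using (hR ω hne).2⟩

lemma integrable_slice {F : Pt d → ℝ} (hF : Continuous F) {R : ℝ}
    (hR : ∀ ω, F ω ≠ 0 → ‖ω.2.1‖ ≤ R ∧ ‖ω.2.2‖ ≤ R) (s : ℝ) :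
    Integrable (fun p : V d × V d => F (s, p)) := by
  refine Continuous.integrable_of_hasCompactSupport (by fun_prop) ?_
  refine HasCompactSupport.of_support_subset_isCompact
    ((isCompact_closedBall (0 : V d) R).prod (isCompact_closedBall (0 : V d) R)) fun p hp => ?_
  exact ⟨by simpa using (hR (s, p) hp).1, by simpa using (hR (s, p) hp).2⟩

end Kinetic

section FlowIdentity

variable {d : ℕ} {β χ : V d → ℝ} {ρ ε : ℝ}

lemma hasFDerivAt_kmul_velocity (z : Pt d) (s : ℝ) (y w : V d) :
    HasFDerivAt (fun w : V d => kmul z (s, y, w))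
      ((0 : V d →L[ℝ] ℝ).prod ((0 : V d →L[ℝ] V d).prod (ContinuousLinearMap.id ℝ (V d)))) w :=
  (hasFDerivAt_const (z.1 + s) w).prodMk ((hasFDerivAt_const (z.2.1 + y + s • z.2.2) w).prodMk
    ((hasFDerivAt_id w).const_add z.2.2))

lemma hasFDerivAt_kmul_position (z : Pt d) (s : ℝ) (y w : V d) :
    HasFDerivAt (fun y : V d => kmul z (s, y, w))
      ((0 : V d →L[ℝ] ℝ).prod ((ContinuousLinearMap.id ℝ (V d)).prod (0 : V d →L[ℝ] V d))) y :=
  (hasFDerivAt_const (z.1 + s) y).prodMk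
    ((((hasFDerivAt_id y).const_add z.2.1).add_const (s • z.2.2)).prodMk
      (hasFDerivAt_const (z.2.2 + w) y))

lemma hasDerivAt_kmul_time (z : Pt d) (s : ℝ) (y w : V d) :
    HasDerivAt (fun s : ℝ => kmul z (s, y, w)) (1, z.2.2, 0) s := by
  have h : HasDerivAt (fun s : ℝ => z.2.1 + y + s • z.2.2) z.2.2 s := by
    simpa using ((hasDerivAt_id s).smul_const z.2.2).const_add (z.2.1 + y)
  exact ((hasDerivAt_id s).const_add z.1).prodMk (h.prodMk (hasDerivAt_const s (z.2.2 + w)))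

lemma sub_eq_integral_transport {f : Pt d → ℝ} (hf : ContDiff ℝ 1 f) (z : Pt d) (y w : V d) :
    f (kmul z (1, y, w)) - f (kmul z (0, y, w)) =
      ∫ s in Set.Ioc (0 : ℝ) 1, fderiv ℝ f (kmul z (s, y, w)) (1, z.2.2, 0) := by
  have hf' := hf.continuous_fderiv one_ne_zero
  have hk : Continuous fun s : ℝ => kmul z (s, y, w) := by unfold kmul; fun_prop
  rw [← intervalIntegral.integral_of_le zero_le_one,
    intervalIntegral.integral_eq_sub_of_hasDerivAt (f := fun s : ℝ => f (kmul z (s, y, w)))]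
  · intro s _
    exact ((hf.differentiable one_ne_zero _).hasFDerivAt).comp_hasDerivAt s
      (hasDerivAt_kmul_time z s y w)
  · apply Continuous.intervalIntegrable
    fun_prop

lemma integral_mul_divergence (hχ : IsMollifier χ ε) {S : Pt d → V d} (hS : ContDiff ℝ 1 S)
    (z : Pt d) (s : ℝ) (y : V d) :
    ∫ w, χ w * ∑ i, fderiv ℝ S (kmul z (s, y, w)) (0, 0, EuclideanSpace.single i 1) i =
      - ∫ w, fderiv ℝ χ w (S (kmul z (s, y, w))) := by
  have hS' := hS.continuous_fderiv one_ne_zero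
  have hS0 := hS.continuous
  have hχ0 := hχ.contDiff.continuous
  have hχ' := hχ.continuous_fderiv
  have hk : Continuous fun w : V d => kmul z (s, y, w) := by unfold kmul; fun_prop
  have hkd : ContDiff ℝ 1 fun w : V d => kmul z (s, y, w) := by unfold kmul; fun_prop
  have h1 : ∀ i, ∫ w, χ w * fderiv ℝ S (kmul z (s, y, w)) (0, 0, EuclideanSpace.single i 1) i =
      - ∫ w, fderiv ℝ χ w (EuclideanSpace.single i 1) * S (kmul z (s, y, w)) i := by
    intro i
    have hg : ContDiff ℝ 1 fun w : V d => S (kmul z (s, y, w)) i := by fun_prop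
    rw [← hχ.integral_mul_fderiv hg]
    congr 1
    ext w
    congr 1
    have hd := ((hS.differentiable one_ne_zero _).hasFDerivAt).comp w
      (hasFDerivAt_kmul_velocity z s y w)
    have hd2 := ((EuclideanSpace.proj (𝕜 := ℝ) i).hasFDerivAt).comp w hd
    have hd3 : fderiv ℝ (fun w : V d => S (kmul z (s, y, w)) i) w = _ := hd2.fderiv
    rw [hd3]
    simp
  have h2 : ∀ w, fderiv ℝ χ w (S (kmul z (s, y, w))) =
      ∑ i, fderiv ℝ χ w (EuclideanSpace.single i 1) * S (kmul z (s, y, w)) i := by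
    intro w
    have hw : S (kmul z (s, y, w))
        = ∑ i, S (kmul z (s, y, w)) i • EuclideanSpace.single i (1 : ℝ) := by
      ext j
      simp [Finset.sum_apply, Pi.single_apply]
    conv_lhs => rw [hw]
    rw [map_sum]
    exact Finset.sum_congr rfl fun i _ => by rw [map_smul, smul_eq_mul, mul_comm]
  simp only [h2, Finset.mul_sum]
  rw [integral_finsetSum, integral_finsetSum, ← Finset.sum_neg_distrib]
  · exact Finset.sum_congr rfl fun i _ => h1 i
  · intro i _
    exact Continuous.integrable_of_hasCompactSupport (by fun_prop)
      ((hχ.hasCompactSupport.fderiv_apply ℝ _).mul_right)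
  · intro i _
    exact Continuous.integrable_of_hasCompactSupport (by fun_prop) hχ.hasCompactSupport.mul_right

lemma integral_mul_fderiv_position (hβ : IsMollifier β ρ) {f : Pt d → ℝ} (hf : ContDiff ℝ 1 f)
    (z : Pt d) (s : ℝ) (w : V d) :
    ∫ y, β y * fderiv ℝ f (kmul z (s, y, w)) (0, w, 0) =
      - ∫ y, fderiv ℝ β y w * (f (kmul z (s, y, w)) - f (kmul z (s, 0, w))) := by
  have hkd : ContDiff ℝ 1 fun y : V d => kmul z (s, y, w) := by unfold kmul; fun_prop
  have hg : ContDiff ℝ 1 fun y : V d => f (kmul z (s, y, w)) - f (kmul z (s, 0, w)) := by fun_prop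
  rw [← hβ.integral_mul_fderiv hg]
  congr 1
  ext y
  congr 1
  have hd := (((hf.differentiable one_ne_zero _).hasFDerivAt).comp y
      (hasFDerivAt_kmul_position z s y w)).sub_const (f (kmul z (s, 0, w)))
  have hd3 : fderiv ℝ (fun y : V d => f (kmul z (s, y, w)) - f (kmul z (s, 0, w))) y = _ := hd.fderiv
  rw [hd3]
  simp

lemma integral_flow_sub_eq (hβ : IsMollifier β ρ) (hχ : IsMollifier χ ε)
    {f : Pt d → ℝ} {S0 : Pt d → V d} {S1 : Pt d → ℝ}
    (hf : ContDiff ℝ 1 f) (hS0 : ContDiff ℝ 1 S0) (hS1 : Continuous S1)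
    (heq : ∀ z : Pt d, fderiv ℝ f z (1, z.2.2, 0) =
      (∑ i : Fin d, fderiv ℝ S0 z (0, 0, EuclideanSpace.single i 1) i) + S1 z) (z : Pt d) :
    ∫ q : V d × V d, β q.1 * χ q.2 * (f (kmul z (1, q)) - f (kmul z (0, q))) =
      ∫ ω, β ω.2.1 * χ ω.2.2 * S1 (kmul z ω) ∂(slab d)
        - ∫ ω, β ω.2.1 * fderiv ℝ χ ω.2.2 (S0 (kmul z ω)) ∂(slab d)
        + ∫ ω, χ ω.2.2 * (fderiv ℝ β ω.2.1 ω.2.2 *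
            (f (kmul z ω) - f (kmul z (ω.1, 0, ω.2.2)))) ∂(slab d) := by
  have hf' := hf.continuous_fderiv one_ne_zero
  have hS0' := hS0.continuous_fderiv one_ne_zero
  have hfc := hf.continuous
  have hS0c := hS0.continuous
  have hβc := hβ.contDiff.continuous
  have hχc := hχ.contDiff.continuous
  have hβ' := hβ.continuous_fderiv
  have hχ' := hχ.continuous_fderiv
  have hk : Continuous fun ω : Pt d => kmul z ω := by unfold kmul; fun_prop
  have hk0 : Continuous fun ω : Pt d => kmul z (ω.1, 0, ω.2.2) := by unfold kmul; fun_prop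
  have hbound : ∀ {y w : V d}, ‖y‖ ≤ ρ → ‖w‖ ≤ ε → ‖y‖ ≤ max ρ ε ∧ ‖w‖ ≤ max ρ ε :=
    fun h1 h2 => ⟨h1.trans (le_max_left _ _), h2.trans (le_max_right _ _)⟩
  have hβχ : ∀ {y w : V d}, β y * χ w ≠ 0 → ‖y‖ ≤ max ρ ε ∧ ‖w‖ ≤ max ρ ε := fun h =>
    hbound (hβ.norm_le_of_ne_zero (left_ne_zero_of_mul h))
      (hχ.norm_le_of_ne_zero (right_ne_zero_of_mul h))
  let F : Pt d → ℝ := fun ω => β ω.2.1 * χ ω.2.2 * fderiv ℝ f (kmul z ω) (1, z.2.2, 0)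
  let F1 : Pt d → ℝ := fun ω => β ω.2.1 * χ ω.2.2 * S1 (kmul z ω)
  let F2 : Pt d → ℝ := fun ω => β ω.2.1 * χ ω.2.2 *
    ∑ i : Fin d, fderiv ℝ S0 (kmul z ω) (0, 0, EuclideanSpace.single i 1) i
  let F3 : Pt d → ℝ := fun ω => β ω.2.1 * χ ω.2.2 * fderiv ℝ f (kmul z ω) (0, ω.2.2, 0)
  let H2 : Pt d → ℝ := fun ω => β ω.2.1 * fderiv ℝ χ ω.2.2 (S0 (kmul z ω))
  let H3 : Pt d → ℝ := fun ω => χ ω.2.2 * (fderiv ℝ β ω.2.1 ω.2.2 *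
    (f (kmul z ω) - f (kmul z (ω.1, 0, ω.2.2))))
  have cF : Continuous F := by fun_prop
  have cF1 : Continuous F1 := by fun_prop
  have cF2 : Continuous F2 := by fun_prop
  have cF3 : Continuous F3 := by fun_prop
  have cH2 : Continuous H2 := by fun_prop
  have cH3 : Continuous H3 := by fun_prop
  have sF : ∀ ω, F ω ≠ 0 → ‖ω.2.1‖ ≤ max ρ ε ∧ ‖ω.2.2‖ ≤ max ρ ε :=
    fun ω h => hβχ (left_ne_zero_of_mul h)
  have sF1 : ∀ ω, F1 ω ≠ 0 → ‖ω.2.1‖ ≤ max ρ ε ∧ ‖ω.2.2‖ ≤ max ρ ε :=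
    fun ω h => hβχ (left_ne_zero_of_mul h)
  have sF2 : ∀ ω, F2 ω ≠ 0 → ‖ω.2.1‖ ≤ max ρ ε ∧ ‖ω.2.2‖ ≤ max ρ ε :=
    fun ω h => hβχ (left_ne_zero_of_mul h)
  have sF3 : ∀ ω, F3 ω ≠ 0 → ‖ω.2.1‖ ≤ max ρ ε ∧ ‖ω.2.2‖ ≤ max ρ ε :=
    fun ω h => hβχ (left_ne_zero_of_mul h)
  have sH2 : ∀ ω, H2 ω ≠ 0 → ‖ω.2.1‖ ≤ max ρ ε ∧ ‖ω.2.2‖ ≤ max ρ ε := fun ω h =>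
    hbound (hβ.norm_le_of_ne_zero (left_ne_zero_of_mul h))
      (hχ.norm_le_of_fderiv_ne_zero fun h0 => right_ne_zero_of_mul h (by rw [h0]; rfl))
  have sH3 : ∀ ω, H3 ω ≠ 0 → ‖ω.2.1‖ ≤ max ρ ε ∧ ‖ω.2.2‖ ≤ max ρ ε := fun ω h =>
    hbound (hβ.norm_le_of_fderiv_ne_zero fun h0 =>
        left_ne_zero_of_mul (right_ne_zero_of_mul h) (by rw [h0]; rfl))
      (hχ.norm_le_of_ne_zero (left_ne_zero_of_mul h))
  have hFsum : ∀ ω, F ω = F2 ω + F1 ω - F3 ω := by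
    intro ω
    have h1 : ((1, z.2.2, 0) : Pt d) = (1, (kmul z ω).2.2, 0) - (0, ω.2.2, 0) := by
      simp [kmul]
    simp only [F, F1, F2, F3]
    rw [h1, map_sub, heq]
    ring
  have hLHS : ∫ q : V d × V d, β q.1 * χ q.2 * (f (kmul z (1, q)) - f (kmul z (0, q))) =
      ∫ ω, F ω ∂(slab d) := by
    have hint := integrable_slab cF sF
    unfold slab at hint ⊢
    rw [integral_prod_symm _ hint]
    congr 1
    ext q
    rw [sub_eq_integral_transport hf z q.1 q.2, ← integral_const_mul]
  have h2 : ∫ ω, F2 ω ∂(slab d) = - ∫ ω, H2 ω ∂(slab d) := by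
    have hint := integrable_slab cF2 sF2
    have hint' := integrable_slab cH2 sH2
    unfold slab at hint hint' ⊢
    rw [integral_prod _ hint, integral_prod _ hint', ← integral_neg]
    congr 1
    ext s
    rw [Measure.volume_eq_prod, integral_prod _ (integrable_slice cF2 sF2 s),
      integral_prod _ (integrable_slice cH2 sH2 s), ← integral_neg]
    congr 1
    ext y
    simp only [F2, H2, mul_assoc]
    rw [integral_const_mul, integral_const_mul, integral_mul_divergence hχ hS0, mul_neg]
  have h3 : ∫ ω, F3 ω ∂(slab d) = - ∫ ω, H3 ω ∂(slab d) := by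
    have hint := integrable_slab cF3 sF3
    have hint' := integrable_slab cH3 sH3
    unfold slab at hint hint' ⊢
    rw [integral_prod _ hint, integral_prod _ hint', ← integral_neg]
    congr 1
    ext s
    rw [Measure.volume_eq_prod, integral_prod_symm _ (integrable_slice cF3 sF3 s),
      integral_prod_symm _ (integrable_slice cH3 sH3 s), ← integral_neg]
    congr 1
    ext w
    simp only [F3, H3, mul_assoc, mul_left_comm _ (χ w)]
    rw [integral_const_mul, integral_const_mul, integral_mul_fderiv_position hβ hf, mul_neg]
  rw [hLHS]
  simp only [hFsum]
  have hF21 : Integrable (fun ω => F2 ω + F1 ω) (slab d) :=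
    (integrable_slab cF2 sF2).add (integrable_slab cF1 sF1)
  rw [integral_sub hF21 (integrable_slab cF3 sF3), integral_add (integrable_slab cF2 sF2) (integrable_slab cF1 sF1),
    h2, h3]
  simp only [F1, H2, H3]
  ring

end FlowIdentity

section FlowEstimate

variable {d : ℕ} {β χ : V d → ℝ} {ρ ε : ℝ} {p q : ℝ≥0∞}

lemma eLpNorm_integral_le_of_enorm_le {Ω : Type*} [MeasurableSpace Ω] {ν : Measure Ω}
    {F : Pt d → Ω → ℝ} {k : Ω → ℝ≥0∞} {G : Pt d → Ω → ℝ≥0∞}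
    (h : ∀ z ω, ‖F z ω‖ₑ ≤ k ω * G z ω) :
    eLpNorm (fun z => ∫ ω, F z ω ∂ν) p volume ≤
      eLpNorm (fun z => ∫⁻ ω, k ω * G z ω ∂ν) p volume := by
  refine eLpNorm_mono_enorm fun z => ?_
  rw [enorm_eq_self]
  exact (enorm_integral_le_lintegral_enorm _).trans (lintegral_mono fun ω => h z ω)

lemma lintegral_slab_mul {a b : V d → ℝ≥0∞} (ha : Measurable a) (hb : Measurable b) :
    ∫⁻ ω, a ω.2.1 * b ω.2.2 ∂(slab d) = (∫⁻ y, a y) * ∫⁻ w, b w := by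
  unfold slab
  rw [lintegral_prod _ (by fun_prop)]
  simp only [lintegral_const, Measure.restrict_apply_univ, Real.volume_Ioc, sub_zero,
    ENNReal.ofReal_one, mul_one]
  rw [Measure.volume_eq_prod, lintegral_prod_mul ha.aemeasurable hb.aemeasurable]

lemma eLpNorm_comp_kmul_right {E : Type*} [NormedAddCommGroup E] {g : Pt d → E}
    (hg : Continuous g) (m : Pt d) :
    eLpNorm (fun z => g (kmul z m)) p volume = eLpNorm g p volume :=
  eLpNorm_comp_measurePreserving (p := p) hg.aestronglyMeasurable (measurePreserving_kmul_right m)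

lemma eLpNorm_flow_source_le (hβ : IsMollifier β ρ) (hχ : IsMollifier χ ε) (hq : 1 ≤ q)
    (hqp : q ≤ p) (hqt : q ≠ ∞) {K : ℝ≥0∞} (hK1 : 1 ≤ K)
    (hK : ∀ y w, ENNReal.ofReal (β y) * ENNReal.ofReal (χ w) ≤ K) {S1 : Pt d → ℝ}
    (hS1 : Continuous S1) :
    eLpNorm (fun z => ∫ ω, β ω.2.1 * χ ω.2.2 * S1 (kmul z ω) ∂(slab d)) p volume ≤
      K * eLpNorm S1 q volume := by
  have hβc := hβ.contDiff.continuous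
  have hχc := hχ.contDiff.continuous
  have hG : Continuous fun a : Pt d × Pt d => S1 (kmul a.1 a.2) := hS1.comp continuous_kmul
  refine (eLpNorm_integral_le_of_enorm_le
    (k := fun ω => ENNReal.ofReal (β ω.2.1) * ENNReal.ofReal (χ ω.2.2))
    (G := fun z ω => ‖S1 (kmul z ω)‖ₑ) fun z ω => ?_).trans
    (eLpNorm_lintegral_mul_le_of_le hq hqp hqt hG.measurable.enorm ?_ ?_ hK1
      (fun ω => hK _ _) (fun ω => ?_) fun z => ?_)
  · rw [enorm_mul, enorm_mul, Real.enorm_of_nonneg (hβ.nonneg _), Real.enorm_of_nonneg (hχ.nonneg _)]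
  · fun_prop
  · rw [lintegral_slab_mul (a := fun y => ENNReal.ofReal (β y))
      (b := fun w => ENNReal.ofReal (χ w)) (by fun_prop) (by fun_prop), hβ.lintegral_ofReal,
      hχ.lintegral_ofReal, one_mul]
  · rw [eLpNorm_enorm (fun z => S1 (kmul z ω)), eLpNorm_comp_kmul_right hS1]
  · rw [eLpNorm_enorm (fun ω => S1 (kmul z ω))]
    exact (eLpNorm_mono_measure _ slab_le).trans (eLpNorm_comp_measurePreserving (p := q)
      hS1.aestronglyMeasurable (measurePreserving_kmul_left z)).le

lemma eLpNorm_flow_divergence_le (hβ : IsMollifier β ρ) (hχ : IsMollifier χ ε) (hp : 1 ≤ p)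
    {S0 : Pt d → V d} (hS0 : Continuous S0) :
    eLpNorm (fun z => ∫ ω, β ω.2.1 * fderiv ℝ χ ω.2.2 (S0 (kmul z ω)) ∂(slab d)) p volume ≤
      (∫⁻ w, ‖fderiv ℝ χ w‖ₑ) * eLpNorm S0 p volume := by
  have hβc := hβ.contDiff.continuous
  have hχc := hχ.continuous_fderiv
  have hG : Continuous fun a : Pt d × Pt d => S0 (kmul a.1 a.2) := hS0.comp continuous_kmul
  have hk : ∫⁻ ω, ENNReal.ofReal (β ω.2.1) * ‖fderiv ℝ χ ω.2.2‖ₑ ∂(slab d) =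
      ∫⁻ w, ‖fderiv ℝ χ w‖ₑ := by
    rw [lintegral_slab_mul (a := fun y => ENNReal.ofReal (β y)) (b := fun w => ‖fderiv ℝ χ w‖ₑ)
      (by fun_prop) hχc.measurable.enorm, hβ.lintegral_ofReal, one_mul]
  rw [← hk]
  have hGm : Measurable (Function.uncurry fun z ω : Pt d => ‖S0 (kmul z ω)‖ₑ) :=
    hG.enorm.measurable
  have hkm : Measurable fun ω : Pt d => ENNReal.ofReal (β ω.2.1) * ‖fderiv ℝ χ ω.2.2‖ₑ :=
    (hβc.measurable.comp (measurable_fst.comp measurable_snd)).ennreal_ofReal.mul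
      (hχc.measurable.comp (measurable_snd.comp measurable_snd)).enorm
  have h1 : ∀ z ω : Pt d, ‖β ω.2.1 * fderiv ℝ χ ω.2.2 (S0 (kmul z ω))‖ₑ ≤
      ENNReal.ofReal (β ω.2.1) * ‖fderiv ℝ χ ω.2.2‖ₑ * ‖S0 (kmul z ω)‖ₑ := by
    intro z ω
    rw [enorm_mul, Real.enorm_of_nonneg (hβ.nonneg _), mul_assoc]
    gcongr
    exact (fderiv ℝ χ ω.2.2).le_opENorm _
  have h2 : ∀ ω : Pt d, eLpNorm (fun z : Pt d => ‖S0 (kmul z ω)‖ₑ) p volume ≤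
      eLpNorm S0 p volume := by
    intro ω
    rw [eLpNorm_enorm (fun z => S0 (kmul z ω)), eLpNorm_comp_kmul_right hS0]
  have h3 : ∫⁻ ω, ENNReal.ofReal (β ω.2.1) * ‖fderiv ℝ χ ω.2.2‖ₑ ∂(slab d) ≠ ∞ := by
    rw [hk]
    exact hχ.lintegral_enorm_fderiv_ne_top
  have h4 := eLpNorm_lintegral_mul_le (μ := (volume : Measure (Pt d))) (ν := slab d) hp hGm hkm h3
    fun ω _ => h2 ω
  exact (eLpNorm_integral_le_of_enorm_le h1).trans h4

lemma eLpNorm_flow_commutator_le (hβ : IsMollifier β ρ) (hχ : IsMollifier χ ε) (hp : 1 ≤ p)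
    {f : Pt d → ℝ} (hf : Continuous f) {B : ℝ≥0∞}
    (hB : ∀ k : V d, ‖k‖ ≤ ρ →
      eLpNorm (fun z : Pt d => f (z.1, z.2.1 + k, z.2.2) - f z) p volume ≤ B) :
    eLpNorm (fun z => ∫ ω, χ ω.2.2 * (fderiv ℝ β ω.2.1 ω.2.2 *
      (f (kmul z ω) - f (kmul z (ω.1, 0, ω.2.2)))) ∂(slab d)) p volume ≤
      ENNReal.ofReal ε * (∫⁻ w, ‖fderiv ℝ β w‖ₑ) * B := by
  have hβc := hβ.continuous_fderiv
  have hχc := hχ.contDiff.continuous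
  have hG : Continuous fun a : Pt d × Pt d =>
      f (kmul a.1 a.2) - f (kmul a.1 (a.2.1, 0, a.2.2.2)) := by
    unfold kmul; fun_prop
  have hk : ∫⁻ ω, (ENNReal.ofReal ε * ‖fderiv ℝ β ω.2.1‖ₑ) * ENNReal.ofReal (χ ω.2.2) ∂(slab d) =
      ENNReal.ofReal ε * ∫⁻ w, ‖fderiv ℝ β w‖ₑ := by
    rw [lintegral_slab_mul (a := fun y => ENNReal.ofReal ε * ‖fderiv ℝ β y‖ₑ)
      (b := fun w => ENNReal.ofReal (χ w)) (by fun_prop) (by fun_prop), hχ.lintegral_ofReal, mul_one, lintegral_const_mul _ hβc.measurable.enorm]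
  rw [← hk]
  refine (eLpNorm_integral_le_of_enorm_le
    (k := fun ω => (ENNReal.ofReal ε * ‖fderiv ℝ β ω.2.1‖ₑ) * ENNReal.ofReal (χ ω.2.2))
    (G := fun z ω => ‖f (kmul z ω) - f (kmul z (ω.1, 0, ω.2.2))‖ₑ) fun z ω => ?_).trans
    (eLpNorm_lintegral_mul_le hp hG.measurable.enorm ?_ ?_ fun ω hω => ?_)
  · rw [enorm_mul, enorm_mul, Real.enorm_of_nonneg (hχ.nonneg _)]
    by_cases hw : χ ω.2.2 = 0
    · simp [hw]
    · have h1 : ‖ω.2.2‖ₑ ≤ ENNReal.ofReal ε := by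
        rw [← ofReal_norm]
        exact ENNReal.ofReal_le_ofReal (hχ.norm_le_of_ne_zero hw)
      calc _ ≤ ENNReal.ofReal (χ ω.2.2) * (‖fderiv ℝ β ω.2.1‖ₑ * ENNReal.ofReal ε *
            ‖f (kmul z ω) - f (kmul z (ω.1, 0, ω.2.2))‖ₑ) := by
            gcongr
            exact (ContinuousLinearMap.le_opENorm _ _).trans (by gcongr)
        _ = _ := by ring
  · fun_prop
  · rw [hk]
    exact ENNReal.mul_ne_top ENNReal.ofReal_ne_top hβ.lintegral_enorm_fderiv_ne_top
  · have hy : ‖ω.2.1‖ ≤ ρ := hβ.norm_le_of_fderiv_ne_zero fun h => hω (by rw [← ofReal_norm (fderiv ℝ β ω.2.1), h]; simp)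
    rw [eLpNorm_enorm (fun z => f (kmul z ω) - f (kmul z (ω.1, 0, ω.2.2)))]
    have hc : Continuous fun z : Pt d => f (z.1, z.2.1 + ω.2.1, z.2.2) - f z := by fun_prop
    have heq : (fun z => f (kmul z ω) - f (kmul z (ω.1, 0, ω.2.2))) =
        fun z => (fun z : Pt d => f (z.1, z.2.1 + ω.2.1, z.2.2) - f z)
          (kmul z (ω.1, 0, ω.2.2)) := by
      ext z
      simp only [kmul]
      congr 3
      simp only [Prod.mk.injEq, and_true]
      abel
    rw [heq, eLpNorm_comp_kmul_right hc]
    exact hB _ hy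

lemma eLpNorm_average_sub_le (hβ : IsMollifier β ρ) (hχ : IsMollifier χ ε) (hp : 1 ≤ p)
    {f : Pt d → ℝ} (hf : ContDiff ℝ 1 f) {B : ℝ≥0∞}
    (hB : ∀ k : V d, ‖k‖ ≤ ρ →
      eLpNorm (fun z : Pt d => f (z.1, z.2.1 + k, z.2.2) - f z) p volume ≤ B) :
    eLpNorm (fun z => ∫ a : V d × V d, β a.1 * χ a.2 * (f (kmul z (0, a)) - f z)) p volume ≤
      B + ENNReal.ofReal ε * eLpNorm (gradV f) p volume := by
  have hβc := hβ.contDiff.continuous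
  have hχc := hχ.contDiff.continuous
  have hfc := hf.continuous
  have hG : Continuous fun a : Pt d × (V d × V d) => f (kmul a.1 (0, a.2)) - f a.1 := by
    unfold kmul; fun_prop
  have hk : ∫⁻ a : V d × V d, ENNReal.ofReal (β a.1) * ENNReal.ofReal (χ a.2) = 1 := by
    rw [Measure.volume_eq_prod, lintegral_prod_mul (f := fun y => ENNReal.ofReal (β y))
      (g := fun y => ENNReal.ofReal (χ y)) (by fun_prop) (by fun_prop), hβ.lintegral_ofReal,
      hχ.lintegral_ofReal, one_mul]
  rw [← one_mul (B + _), ← hk]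
  refine (eLpNorm_integral_le_of_enorm_le
    (k := fun a : V d × V d => ENNReal.ofReal (β a.1) * ENNReal.ofReal (χ a.2))
    (G := fun z a => ‖f (kmul z (0, a)) - f z‖ₑ) fun z a => ?_).trans
    (eLpNorm_lintegral_mul_le hp hG.measurable.enorm ?_ ?_ fun a ha => ?_)
  · rw [enorm_mul, enorm_mul, Real.enorm_of_nonneg (hβ.nonneg _), Real.enorm_of_nonneg (hχ.nonneg _)]
  · fun_prop
  · simp [hk]
  · have hy : ‖a.1‖ ≤ ρ := hβ.norm_le_of_ne_zero fun h => ha (by simp [h])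
    have hw : ‖a.2‖ ≤ ε := hχ.norm_le_of_ne_zero fun h => ha (by simp [h])
    rw [eLpNorm_enorm (fun z => f (kmul z (0, a)) - f z)]
    have hc : Continuous fun z : Pt d => f (z.1, z.2.1 + a.1, z.2.2) - f z := by fun_prop
    have hc2 : Continuous fun z : Pt d => f (z.1, z.2.1, z.2.2 + a.2) - f z := by fun_prop
    have hc3 : Continuous fun z : Pt d => kmul z (0, 0, a.2) := by unfold kmul; fun_prop
    have heq : (fun z => f (kmul z (0, a)) - f z) =
        (fun z => (fun z : Pt d => f (z.1, z.2.1 + a.1, z.2.2) - f z) (kmul z (0, 0, a.2))) +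
          fun z : Pt d => f (z.1, z.2.1, z.2.2 + a.2) - f z := by
      ext z
      simp [kmul]
    rw [heq]
    refine (eLpNorm_add_le (hc.comp hc3).aestronglyMeasurable
      hc2.aestronglyMeasurable hp).trans ?_
    rw [Function.comp_def, eLpNorm_comp_kmul_right hc]
    exact add_le_add (hB _ hy) ((eLpNorm_velocity_shift_le hp hf a.2).trans (by gcongr))

lemma aestronglyMeasurable_integral_of_continuous {Ω : Type*} [TopologicalSpace Ω]
    [SecondCountableTopology Ω] [MeasurableSpace Ω] [OpensMeasurableSpace Ω] {ν : Measure Ω} [SFinite ν]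
    {F : Pt d → Ω → ℝ} (hF : Continuous (Function.uncurry F)) :
    AEStronglyMeasurable (fun z => ∫ ω, F z ω ∂ν) volume :=
  (StronglyMeasurable.integral_prod_right hF.stronglyMeasurable).aestronglyMeasurable

lemma eLpNorm_flow_sub_le (hβ : IsMollifier β ρ) (hχ : IsMollifier χ ε) (hq : 1 ≤ q)
    (hqp : q ≤ p) (hqt : q ≠ ∞) {K : ℝ≥0∞} (hK1 : 1 ≤ K)
    (hK : ∀ y w, ENNReal.ofReal (β y) * ENNReal.ofReal (χ w) ≤ K)
    {f : Pt d → ℝ} {S0 : Pt d → V d} {S1 : Pt d → ℝ}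
    (hf : ContDiff ℝ 1 f) (hS0 : ContDiff ℝ 1 S0) (hS1 : Continuous S1)
    (heq : ∀ z : Pt d, fderiv ℝ f z (1, z.2.2, 0) =
      (∑ i : Fin d, fderiv ℝ S0 z (0, 0, EuclideanSpace.single i 1) i) + S1 z) {B : ℝ≥0∞}
    (hB : ∀ k : V d, ‖k‖ ≤ ρ →
      eLpNorm (fun z : Pt d => f (z.1, z.2.1 + k, z.2.2) - f z) p volume ≤ B) :
    eLpNorm (fun z => f (kmul z (1, 0, 0)) - f z) p volume ≤
      2 * (B + ENNReal.ofReal ε * eLpNorm (gradV f) p volume) + K * eLpNorm S1 q volume +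
        (∫⁻ w, ‖fderiv ℝ χ w‖ₑ) * eLpNorm S0 p volume +
        ENNReal.ofReal ε * (∫⁻ w, ‖fderiv ℝ β w‖ₑ) * B := by
  have hp : 1 ≤ p := hq.trans hqp
  have hβc := hβ.contDiff.continuous
  have hχc := hχ.contDiff.continuous
  have hβ' := hβ.continuous_fderiv
  have hχ' := hχ.continuous_fderiv
  have hfc := hf.continuous
  have hS0c := hS0.continuous
  let P : Pt d → ℝ := fun z => ∫ a : V d × V d, β a.1 * χ a.2 * (f (kmul z (0, a)) - f z)
  let T1 : Pt d → ℝ := fun z => ∫ ω, β ω.2.1 * χ ω.2.2 * S1 (kmul z ω) ∂(slab d)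
  let T2 : Pt d → ℝ := fun z => ∫ ω, β ω.2.1 * fderiv ℝ χ ω.2.2 (S0 (kmul z ω)) ∂(slab d)
  let T3 : Pt d → ℝ := fun z => ∫ ω, χ ω.2.2 * (fderiv ℝ β ω.2.1 ω.2.2 *
      (f (kmul z ω) - f (kmul z (ω.1, 0, ω.2.2)))) ∂(slab d)
  have hk := continuous_kmul (d := d)
  have mP : AEStronglyMeasurable P volume := by
    apply aestronglyMeasurable_integral_of_continuous
    unfold Function.uncurry kmul; fun_prop
  have mT1 : AEStronglyMeasurable T1 volume := by
    apply aestronglyMeasurable_integral_of_continuous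
    unfold Function.uncurry kmul; fun_prop
  have mT2 : AEStronglyMeasurable T2 volume := by
    apply aestronglyMeasurable_integral_of_continuous
    unfold Function.uncurry kmul; fun_prop
  have mT3 : AEStronglyMeasurable T3 volume := by
    apply aestronglyMeasurable_integral_of_continuous
    unfold Function.uncurry kmul; fun_prop
  have mp := measurePreserving_kmul_right (d := d) (1, 0, 0)
  have hcomp : ∀ z a, kmul (kmul z (1, 0, 0)) ((0, a) : Pt d) = kmul z (1, a) := by
    intro z a
    simp only [kmul]
    ext <;> simp
    ring
  have hcs : HasCompactSupport fun a : V d × V d => β a.1 * χ a.2 :=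
    HasCompactSupport.of_support_subset_isCompact
      ((isCompact_closedBall (0 : V d) ρ).prod (isCompact_closedBall (0 : V d) ε)) fun a ha =>
      ⟨by simpa using hβ.norm_le_of_ne_zero (left_ne_zero_of_mul ha),
        by simpa using hχ.norm_le_of_ne_zero (right_ne_zero_of_mul ha)⟩
  have hint : ∀ g : V d × V d → ℝ, Continuous g →
      Integrable fun a : V d × V d => β a.1 * χ a.2 * g a := fun g hg =>
    Continuous.integrable_of_hasCompactSupport (by fun_prop) hcs.mul_right
  have hone : ∫ a : V d × V d, β a.1 * χ a.2 = 1 := by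
    rw [Measure.volume_eq_prod, integral_prod_mul, hβ.integral_eq_one, hχ.integral_eq_one, one_mul]
  have hP : ∀ z, P z = (∫ a : V d × V d, β a.1 * χ a.2 * f (kmul z (0, a))) - f z := by
    intro z
    simp only [P, mul_sub]
    rw [integral_sub (hint _ (by unfold kmul; fun_prop)) (hint _ (by fun_prop)),
      integral_mul_const, hone, one_mul]
  have hmain : (fun z => f (kmul z (1, 0, 0)) - f z) =
      P - (fun z => P (kmul z (1, 0, 0))) + T1 - T2 + T3 := by
    ext z
    have h := integral_flow_sub_eq hβ hχ hf hS0 hS1 heq z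
    simp only [mul_sub (_ * _)] at h
    rw [integral_sub (hint _ (by unfold kmul; fun_prop)) (hint _ (by unfold kmul; fun_prop))] at h
    simp only [Pi.add_apply, Pi.sub_apply, hP, hcomp, T1, T2, T3]
    linarith
  have hPn := eLpNorm_average_sub_le hβ hχ hp hf hB
  have mP' : AEStronglyMeasurable (fun z => P (kmul z (1, 0, 0))) volume :=
    mP.comp_measurePreserving mp
  have hPn' : eLpNorm (fun z => P (kmul z (1, 0, 0))) p volume = eLpNorm P p volume :=
    eLpNorm_comp_measurePreserving (p := p) mP mp
  rw [hmain, two_mul]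
  refine (eLpNorm_add_le (((mP.sub mP').add mT1).sub mT2) mT3 hp).trans (add_le_add ?_
    (eLpNorm_flow_commutator_le hβ hχ hp hfc hB))
  refine (eLpNorm_sub_le ((mP.sub mP').add mT1) mT2 hp).trans (add_le_add ?_
    (eLpNorm_flow_divergence_le hβ hχ hp hS0c))
  refine (eLpNorm_add_le (mP.sub mP') mT1 hp).trans (add_le_add ?_
    (eLpNorm_flow_source_le hβ hχ hq hqp hqt hK1 hK hS1))
  refine (eLpNorm_sub_le mP mP' hp).trans (add_le_add hPn ?_)
  rw [hPn']
  exact hPn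

end FlowEstimate

section UnitShift

variable {d : ℕ} {p q : ℝ≥0∞}

lemma eLpNorm_position_shift_le_flow (hp : 1 ≤ p) {f : Pt d → ℝ} (hf : ContDiff ℝ 1 f) (h : V d) :
    eLpNorm (fun z : Pt d => f (z.1, z.2.1 + h, z.2.2) - f z) p volume ≤
      2 * eLpNorm (fun z => f (kmul z (1, 0, 0)) - f z) p volume +
        2 * (ENNReal.ofReal ‖h‖ * eLpNorm (gradV f) p volume) := by
  have hfc := hf.continuous
  let F : Pt d → ℝ := fun z => f (kmul z (1, 0, 0)) - f z
  let W : Pt d → ℝ := fun z => f (z.1, z.2.1, z.2.2 + h) - f z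
  have cF : Continuous F := by simp only [F, kmul]; fun_prop
  have cW : Continuous W := by simp only [W]; fun_prop
  have cc : ∀ {g : Pt d → ℝ} (_ : Continuous g) (m : Pt d),
      AEStronglyMeasurable (fun z => g (kmul z m)) volume := fun hg m =>
    hg.aestronglyMeasurable.comp_measurePreserving (measurePreserving_kmul_right m)
  have heq : (fun z : Pt d => f (z.1, z.2.1 + h, z.2.2) - f z) =
      (fun z => F (kmul z (0, 0, h))) - (fun z => F (kmul z (0, h, 0))) -
        (fun z => W (kmul z (1, h, 0))) + W := by
    ext z
    simp only [F, W, kmul, Pi.add_apply, Pi.sub_apply, zero_smul, add_zero, one_smul]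
    have e1 : z.2.1 + (z.2.2 + h) = z.2.1 + h + z.2.2 := by abel
    rw [e1]
    ring
  have hW : eLpNorm W p volume ≤ ENNReal.ofReal ‖h‖ * eLpNorm (gradV f) p volume :=
    eLpNorm_velocity_shift_le hp hf h
  rw [heq, two_mul, two_mul, ← add_assoc]
  refine (eLpNorm_add_le (((cc cF _).sub (cc cF _)).sub (cc cW _)) cW.aestronglyMeasurable hp).trans
    (add_le_add ?_ hW)
  refine (eLpNorm_sub_le ((cc cF _).sub (cc cF _)) (cc cW _) hp).trans (add_le_add ?_ ?_)
  · refine (eLpNorm_sub_le (cc cF _) (cc cF _) hp).trans (add_le_add ?_ ?_)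
    · rw [eLpNorm_comp_kmul_right cF]
    · rw [eLpNorm_comp_kmul_right cF]
  · rw [eLpNorm_comp_kmul_right cW]
    exact hW

lemma IsMollifier.exists_ofReal_le {β : V d → ℝ} {ρ : ℝ} (hβ : IsMollifier β ρ) :
    ∃ b : ℝ, ∀ y, ENNReal.ofReal (β y) ≤ ENNReal.ofReal b := by
  obtain ⟨b, hb⟩ := hβ.hasCompactSupport.exists_bound_of_continuous hβ.contDiff.continuous
  exact ⟨b, fun y => ENNReal.ofReal_le_ofReal ((le_abs_self _).trans (hb y))⟩

lemma exists_unit_position_shift_bound (d : ℕ) (hq : 1 ≤ q) (hqp : q ≤ p) (hqt : q ≠ ∞) :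
    ∃ C : ℝ≥0∞, C ≠ ∞ ∧ ∀ (f : Pt d → ℝ) (S0 : Pt d → V d) (S1 : Pt d → ℝ),
      ContDiff ℝ 1 f → ContDiff ℝ 1 S0 → Continuous S1 →
      (∀ z : Pt d, fderiv ℝ f z (1, z.2.2, 0) =
        (∑ i : Fin d, fderiv ℝ S0 z (0, 0, EuclideanSpace.single i 1) i) + S1 z) →
      ∀ B : ℝ≥0∞, (∀ k : V d, eLpNorm (fun z : Pt d => f (z.1, z.2.1 + k, z.2.2) - f z) p volume ≤
        ENNReal.ofReal (‖k‖ ^ ((1 : ℝ) / 3)) * B) →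
      ∀ h : V d, ‖h‖ = 1 →
        eLpNorm (fun z : Pt d => f (z.1, z.2.1 + h, z.2.2) - f z) p volume ≤
          C * (eLpNorm S0 p volume + eLpNorm (gradV f) p volume + eLpNorm S1 q volume) + B / 2 := by
  have hp : 1 ≤ p := hq.trans hqp
  obtain ⟨β, hβ⟩ := IsMollifier.exists_of_pos (d := d) (ρ := 1 / 1728) (by norm_num)
  set Cβ := ∫⁻ y, ‖fderiv ℝ β y‖ₑ with hCβ
  have hCβt : Cβ ≠ ∞ := hβ.lintegral_enorm_fderiv_ne_top
  obtain ⟨ε, hε0, hε1, hεC⟩ : ∃ ε : ℝ, 0 < ε ∧ ε ≤ 1 ∧ ENNReal.ofReal ε * Cβ ≤ 1 := by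
    refine ⟨1 / (1 + Cβ.toReal), by positivity, ?_, ?_⟩
    · rw [div_le_one (by positivity)]
      linarith [Cβ.toReal_nonneg]
    · rw [← ENNReal.ofReal_toReal hCβt, ← ENNReal.ofReal_mul (by positivity),
        ENNReal.toReal_ofReal Cβ.toReal_nonneg, ENNReal.ofReal_le_one, one_div_mul_eq_div,
        div_le_one (by positivity)]
      linarith
  obtain ⟨χ, hχ⟩ := IsMollifier.exists_of_pos (d := d) hε0
  set Cχ := ∫⁻ y, ‖fderiv ℝ χ y‖ₑ with hCχ
  have hCχt : Cχ ≠ ∞ := hχ.lintegral_enorm_fderiv_ne_top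
  obtain ⟨b1, hb1⟩ := hβ.exists_ofReal_le
  obtain ⟨b2, hb2⟩ := hχ.exists_ofReal_le
  set K : ℝ≥0∞ := max 1 (ENNReal.ofReal b1 * ENNReal.ofReal b2)
  have hKt : K ≠ ∞ := by simp [K, ENNReal.mul_eq_top]
  refine ⟨6 + 2 * K + 2 * Cχ, by finiteness, ?_⟩
  intro f S0 S1 hf hS0 hS1 heq B hB h hh
  have hB' : ∀ k : V d, ‖k‖ ≤ 1 / 1728 →
      eLpNorm (fun z : Pt d => f (z.1, z.2.1 + k, z.2.2) - f z) p volume ≤ 12⁻¹ * B := by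
    intro k hk
    refine (hB k).trans ?_
    gcongr
    have h1 : ‖k‖ ^ ((1 : ℝ) / 3) ≤ 1 / 12 := by
      calc ‖k‖ ^ ((1 : ℝ) / 3) ≤ (1 / 1728 : ℝ) ^ ((1 : ℝ) / 3) := by gcongr
        _ = ((1 / 12 : ℝ) ^ (3 : ℝ)) ^ ((1 : ℝ) / 3) := by norm_num
        _ = 1 / 12 := by
          rw [← Real.rpow_mul (by norm_num)]
          norm_num
    refine (ENNReal.ofReal_le_ofReal h1).trans ?_
    rw [one_div, ENNReal.ofReal_inv_of_pos (by norm_num)]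
    simp
  have hK : ∀ y w, ENNReal.ofReal (β y) * ENNReal.ofReal (χ w) ≤ K := fun y w =>
    (mul_le_mul' (hb1 y) (hb2 w)).trans (le_max_right _ _)
  have hflow := eLpNorm_flow_sub_le hβ hχ hq hqp hqt (le_max_left _ _) hK hf hS0 hS1 heq hB'
  have hshift := eLpNorm_position_shift_le_flow hp hf h
  rw [hh, ENNReal.ofReal_one, one_mul] at hshift
  refine hshift.trans ?_
  set N0 := eLpNorm S0 p volume
  set G := eLpNorm (gradV f) p volume
  set N1 := eLpNorm S1 q volume
  have hε1' : ENNReal.ofReal ε ≤ 1 := by simpa using hε1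
  have hB2 : (12⁻¹ * B) * 6 = B / 2 := by
    have : (12⁻¹ * 6 : ℝ≥0∞) = 2⁻¹ := by
      have h26 : (12 : ℝ≥0∞) = 2 * 6 := by norm_num
      rw [h26, ENNReal.mul_inv (by simp) (by simp), mul_assoc,
        ENNReal.inv_mul_cancel (by simp) (by simp), mul_one]
    rw [mul_right_comm, this, ENNReal.div_eq_inv_mul]
  calc _ ≤ 2 * (2 * (12⁻¹ * B + 1 * G) + K * N1 + Cχ * N0 + 1 * (12⁻¹ * B)) + 2 * G := by
        refine add_le_add_left (mul_le_mul_right (hflow.trans ?_) 2) _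
        gcongr
    _ = 2 * Cχ * N0 + 6 * G + 2 * K * N1 + B / 2 := by
        rw [← hB2]
        ring
    _ ≤ _ := by
        rw [mul_add, mul_add]
        gcongr
        · exact le_add_self
        · rw [add_assoc]
          exact le_self_add
        · rw [add_right_comm]
          exact le_add_self

end UnitShift

section Scaling

variable {d : ℕ} {p q : ℝ≥0∞}

/-- The kinetic dilation `(t, x, v) ↦ (r² t, r³ x, r v)`. -/
def dilation (d : ℕ) (r : ℝ) : Pt d →L[ℝ] Pt d :=
  (r ^ 2 • ContinuousLinearMap.id ℝ ℝ).prodMap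
    ((r ^ 3 • ContinuousLinearMap.id ℝ (V d)).prodMap (r • ContinuousLinearMap.id ℝ (V d)))

lemma dilation_apply (r : ℝ) (z : Pt d) :
    dilation d r z = (r ^ 2 * z.1, r ^ 3 • z.2.1, r • z.2.2) := rfl

lemma map_dilation_volume {r : ℝ} (hr : 0 < r) :
    Measure.map (dilation d r) volume =
      ENNReal.ofReal ((r ^ (4 * d + 2))⁻¹) • (volume : Measure (Pt d)) := by
  have h1 := Measure.map_addHaar_smul (volume : Measure ℝ) (r := r ^ 2) (by positivity)
  have h2 := Measure.map_addHaar_smul (volume : Measure (V d)) (r := r ^ 3) (by positivity)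
  have h3 := Measure.map_addHaar_smul (volume : Measure (V d)) (r := r) (by positivity)
  have h4 : Measure.map (Prod.map (fun x : V d => r ^ 3 • x) fun v : V d => r • v) volume =
      ENNReal.ofReal ((r ^ (4 * d))⁻¹) • (volume : Measure (V d × V d)) := by
    rw [Measure.volume_eq_prod, ← Measure.map_prod_map _ _ (by fun_prop) (by fun_prop), h2, h3,
      Measure.prod_smul_left, Measure.prod_smul_right, smul_smul,
      ← ENNReal.ofReal_mul (by positivity), abs_of_pos (by positivity), abs_of_pos (by positivity)]
    congr 2
    rw [← mul_inv]
    congr 1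
    simp only [finrank_euclideanSpace, Fintype.card_fin]
    ring
  have h5 : (dilation d r : Pt d → Pt d) = Prod.map (fun t : ℝ => r ^ 2 • t)
      (Prod.map (fun x : V d => r ^ 3 • x) fun v : V d => r • v) := rfl
  rw [h5, Measure.volume_eq_prod, ← Measure.map_prod_map _ _ (by fun_prop) (by fun_prop), h1, h4,
    Measure.prod_smul_left, Measure.prod_smul_right, smul_smul,
    ← ENNReal.ofReal_mul (by positivity), abs_of_pos (by positivity)]
  congr 2
  rw [← mul_inv]
  congr 1
  simp only [Module.finrank_self]
  ring

lemma eLpNorm_comp_dilation {E : Type*} [NormedAddCommGroup E] {r : ℝ} (hr : 0 < r) {g : Pt d → E}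
    (hg : Continuous g) :
    eLpNorm (fun z => g (dilation d r z)) p volume =
      ENNReal.ofReal ((r ^ (4 * d + 2))⁻¹) ^ (1 / p).toReal * eLpNorm g p volume := by
  have h := eLpNorm_map_measure (p := p) (μ := (volume : Measure (Pt d))) (f := dilation d r)
    (g := g) hg.aestronglyMeasurable (dilation d r).continuous.aemeasurable
  rw [map_dilation_volume hr, eLpNorm_smul_measure_of_ne_zero (by simp; positivity)] at h
  exact h.symm

lemma fderiv_comp_dilation {E : Type*} [NormedAddCommGroup E] [NormedSpace ℝ E] (r : ℝ)
    {g : Pt d → E} (hg : ContDiff ℝ 1 g) (z e : Pt d) :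
    fderiv ℝ (fun z => g (dilation d r z)) z e = fderiv ℝ g (dilation d r z) (dilation d r e) := by
  have h := ((hg.differentiable one_ne_zero (dilation d r z)).hasFDerivAt).comp z
    (dilation d r).hasFDerivAt
  have h2 : fderiv ℝ (fun z => g (dilation d r z)) z = _ := h.fderiv
  rw [h2]
  rfl

lemma continuous_gradV {g : Pt d → ℝ} (hg : ContDiff ℝ 1 g) : Continuous (gradV g) := by
  have h := hg.continuous_fderiv one_ne_zero
  unfold gradV mkV
  exact (EuclideanSpace.equiv (Fin d) ℝ).symm.continuous.comp
    (continuous_pi fun i => h.clm_apply continuous_const)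

lemma gradV_comp_dilation (r : ℝ) {g : Pt d → ℝ} (hg : ContDiff ℝ 1 g) :
    gradV (fun z => g (dilation d r z)) = r • fun z => gradV g (dilation d r z) := by
  ext z i
  change fderiv ℝ (fun z => g (dilation d r z)) z (0, 0, EuclideanSpace.single i 1) =
    r * fderiv ℝ g (dilation d r z) (0, 0, EuclideanSpace.single i 1)
  rw [fderiv_comp_dilation r hg, ← smul_eq_mul r, ← map_smul]
  congr 1
  simp [dilation_apply]

lemma transport_comp_dilation (r : ℝ) {f : Pt d → ℝ} {S0 : Pt d → V d} {S1 : Pt d → ℝ}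
    (hf : ContDiff ℝ 1 f) (hS0 : ContDiff ℝ 1 S0)
    (heq : ∀ z : Pt d, fderiv ℝ f z (1, z.2.2, 0) =
      (∑ i : Fin d, fderiv ℝ S0 z (0, 0, EuclideanSpace.single i 1) i) + S1 z) (z : Pt d) :
    fderiv ℝ (fun z => f (dilation d r z)) z (1, z.2.2, 0) =
      (∑ i : Fin d, fderiv ℝ (r • fun z => S0 (dilation d r z)) z
        (0, 0, EuclideanSpace.single i 1) i) + (r ^ 2 • fun z => S1 (dilation d r z)) z := by
  have h1 : dilation d r (1, z.2.2, 0) = r ^ 2 • (1, (dilation d r z).2.2, 0) := by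
    simp only [dilation_apply, Prod.smul_mk, smul_smul, smul_zero, smul_eq_mul]
    ring_nf
  have h2 : ∀ i : Fin d, dilation d r (0, 0, EuclideanSpace.single i 1) =
      r • (0, 0, EuclideanSpace.single i 1) := by
    intro i
    simp [dilation_apply]
  have hd : Differentiable ℝ fun z => S0 (dilation d r z) :=
    (hS0.differentiable one_ne_zero).comp (dilation d r).differentiable
  rw [fderiv_comp_dilation r hf, h1, map_smul, heq, smul_add, Finset.smul_sum]
  congr 1
  refine Finset.sum_congr rfl fun i _ => ?_
  rw [fderiv_const_smul (hd z), _root_.smul_apply, fderiv_comp_dilation r hS0, h2,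
    map_smul, PiLp.smul_apply, PiLp.smul_apply, smul_smul, pow_two]

lemma exists_position_shift_bound (d : ℕ) (hq : 1 ≤ q) (hqp : q ≤ p) (hqt : q ≠ ∞)
    (hpq : 1 / q = 1 / p + (((4 * d + 2 : ℕ) : ℝ≥0∞))⁻¹) :
    ∃ C : ℝ≥0∞, C ≠ ∞ ∧ ∀ (f : Pt d → ℝ) (S0 : Pt d → V d) (S1 : Pt d → ℝ),
      ContDiff ℝ 1 f → ContDiff ℝ 1 S0 → Continuous S1 →
      (∀ z : Pt d, fderiv ℝ f z (1, z.2.2, 0) =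
        (∑ i : Fin d, fderiv ℝ S0 z (0, 0, EuclideanSpace.single i 1) i) + S1 z) →
      ∀ B : ℝ≥0∞, (∀ k : V d, eLpNorm (fun z : Pt d => f (z.1, z.2.1 + k, z.2.2) - f z) p volume ≤
        ENNReal.ofReal (‖k‖ ^ ((1 : ℝ) / 3)) * B) →
      ∀ h : V d, h ≠ 0 →
        eLpNorm (fun z : Pt d => f (z.1, z.2.1 + h, z.2.2) - f z) p volume ≤
          ENNReal.ofReal (‖h‖ ^ ((1 : ℝ) / 3)) *
            (C * (eLpNorm S0 p volume + eLpNorm (gradV f) p volume + eLpNorm S1 q volume) +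
              B / 2) := by
  obtain ⟨C, hC, H⟩ := exists_unit_position_shift_bound d hq hqp hqt
  refine ⟨C, hC, ?_⟩
  intro f S0 S1 hf hS0 hS1 heq B hB h hh
  have hh0 : 0 < ‖h‖ := norm_pos_iff.2 hh
  set r : ℝ := ‖h‖ ^ ((1 : ℝ) / 3) with hrdef
  have hr : 0 < r := by positivity
  have hr3 : r ^ 3 = ‖h‖ := by
    rw [hrdef, ← Real.rpow_natCast, ← Real.rpow_mul hh0.le]
    norm_num
  set c : ℝ≥0∞ := ENNReal.ofReal ((r ^ (4 * d + 2))⁻¹) with hcdef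
  have hc0 : c ≠ 0 := by simp only [hcdef, ne_eq, ENNReal.ofReal_eq_zero, not_le]; positivity
  have hct : c ≠ ∞ := ENNReal.ofReal_ne_top
  set a : ℝ≥0∞ := c ^ (1 / p).toReal with hadef
  have ha0 : a ≠ 0 := by simp [hadef, ENNReal.rpow_eq_zero_iff, hc0, hct]
  have hat : a ≠ ∞ := by simp [hadef, ENNReal.rpow_eq_top_iff, hc0, hct]
  have hp0 : 1 / p ≠ ∞ := by
    intro h0
    rw [h0, top_add] at hpq
    simp at hpq
    simp [hpq] at hq
  have hcq : ENNReal.ofReal (r ^ 2) * c ^ (1 / q).toReal = ENNReal.ofReal r * a := by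
    have h1 : (1 / q).toReal = (1 / p).toReal + ((4 * d + 2 : ℕ) : ℝ)⁻¹ := by
      rw [hpq, ENNReal.toReal_add hp0 (by simp), ENNReal.toReal_inv, ENNReal.toReal_natCast]
    have h2 : c ^ (((4 * d + 2 : ℕ) : ℝ)⁻¹) = ENNReal.ofReal r⁻¹ := by
      rw [hcdef, ENNReal.ofReal_rpow_of_pos (by positivity), ← inv_pow,
        Real.pow_rpow_inv_natCast (by positivity) (by lia)]
    rw [h1, ENNReal.rpow_add _ _ hc0 hct, h2, mul_left_comm, ← ENNReal.ofReal_mul (by positivity),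
      mul_comm]
    congr 2
    field_simp
  have hshift : ∀ k : V d,
      eLpNorm (fun z : Pt d => f (dilation d r (z.1, z.2.1 + k, z.2.2)) - f (dilation d r z)) p
        volume = a * eLpNorm (fun z : Pt d => f (z.1, z.2.1 + r ^ 3 • k, z.2.2) - f z) p volume := by
    intro k
    have hfc := hf.continuous
    rw [hadef, hcdef, ← eLpNorm_comp_dilation hr (by fun_prop)]
    simp only [dilation_apply, smul_add]
  have hsm : ∀ k : V d, ENNReal.ofReal (‖r ^ 3 • k‖ ^ ((1 : ℝ) / 3)) =
      ENNReal.ofReal r * ENNReal.ofReal (‖k‖ ^ ((1 : ℝ) / 3)) := by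
    intro k
    rw [norm_smul, Real.norm_of_nonneg (by positivity), hr3, Real.mul_rpow hh0.le (norm_nonneg k),
      ENNReal.ofReal_mul hr.le]
  have hdil := (dilation d r).contDiff (n := 1)
  have key := H (fun z => f (dilation d r z)) (r • fun z => S0 (dilation d r z))
    (r ^ 2 • fun z => S1 (dilation d r z)) (hf.comp hdil) ((hS0.comp hdil).const_smul r)
    ((hS1.comp hdil.continuous).const_smul (r ^ 2)) (transport_comp_dilation r hf hS0 heq)
    (ENNReal.ofReal r * a * B) (fun k => by
      rw [hshift]
      refine (mul_le_mul_right (hB _) a).trans (le_of_eq ?_)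
      rw [hsm]
      ring) ((r ^ 3)⁻¹ • h) (by
      rw [norm_smul, norm_inv, Real.norm_of_nonneg (by positivity), hr3, inv_mul_cancel₀ hh0.ne'])
  rw [hshift, smul_smul, mul_inv_cancel₀ (by positivity), one_smul, gradV_comp_dilation r hf,
    eLpNorm_const_smul, eLpNorm_const_smul, eLpNorm_const_smul,
    eLpNorm_comp_dilation hr hS0.continuous, eLpNorm_comp_dilation hr (continuous_gradV hf),
    eLpNorm_comp_dilation hr hS1, Real.enorm_of_nonneg hr.le, Real.enorm_of_nonneg (by positivity),
    ← hcdef, ← hadef, ← mul_assoc (ENNReal.ofReal (r ^ 2)), hcq] at key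
  rw [← ENNReal.mul_le_mul_iff_right ha0 hat]
  refine key.trans (le_of_eq ?_)
  simp only [div_eq_mul_inv]
  ring

end Scaling

section Absorption

variable {d : ℕ} {p q : ℝ≥0∞}

lemma one_le_of_one_div_eq_add
    (hp : ENNReal.ofReal ((4 * (d : ℝ) + 2) / (4 * (d : ℝ) + 1)) ≤ p)
    (hq : 1 / q = 1 / p + (((4 * d + 2 : ℕ) : ℝ≥0∞))⁻¹) : 1 ≤ q := by
  have hinv : p⁻¹ ≤ ENNReal.ofReal ((4 * (d : ℝ) + 1) / (4 * (d : ℝ) + 2)) := by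
    rw [ENNReal.inv_le_iff_inv_le, ← ENNReal.ofReal_inv_of_pos (by positivity), inv_div]
    exact hp
  have hQ : (((4 * d + 2 : ℕ) : ℝ≥0∞))⁻¹ = ENNReal.ofReal (1 / (4 * (d : ℝ) + 2)) := by
    rw [one_div, ENNReal.ofReal_inv_of_pos (by positivity), ← ENNReal.ofReal_natCast]
    push_cast
    rfl
  rw [← ENNReal.inv_le_one, ← one_div, hq, hQ, one_div]
  calc _ ≤ ENNReal.ofReal ((4 * (d : ℝ) + 1) / (4 * (d : ℝ) + 2)) +
        ENNReal.ofReal (1 / (4 * (d : ℝ) + 2)) := by gcongr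
    _ = ENNReal.ofReal 1 := by
        rw [← ENNReal.ofReal_add (by positivity) (by positivity)]
        congr 1
        field_simp
        ring
    _ = 1 := ENNReal.ofReal_one

lemma eLpNorm_position_shift_le (hp : 1 ≤ p) {f : Pt d → ℝ} (hf : ContDiff ℝ 1 f) (h : V d) :
    eLpNorm (fun z : Pt d => f (z.1, z.2.1 + h, z.2.2) - f z) p volume ≤
      ENNReal.ofReal (‖h‖ ^ ((1 : ℝ) / 3)) *
        (2 * eLpNorm f p volume + eLpNorm (fderiv ℝ f) p volume) := by
  have hshift : ∀ z : Pt d, (z.1, z.2.1 + h, z.2.2) = z + ((0, h, 0) : Pt d) := fun z => by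
    ext <;> simp
  simp only [hshift]
  rcases le_total 1 ‖h‖ with h1 | h1
  · have hone : 1 ≤ ENNReal.ofReal (‖h‖ ^ ((1 : ℝ) / 3)) := by
      rw [ENNReal.one_le_ofReal]
      exact Real.one_le_rpow h1 (by norm_num)
    have hmp : MeasurePreserving (fun z : Pt d => z + ((0, h, 0) : Pt d)) volume volume :=
      measurePreserving_add_right volume _
    have hfm := hf.continuous.aestronglyMeasurable (μ := (volume : Measure (Pt d)))
    calc _ ≤ eLpNorm (fun z => f (z + ((0, h, 0) : Pt d))) p volume + eLpNorm f p volume :=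
          eLpNorm_sub_le (hfm.comp_measurePreserving hmp) hfm hp
      _ = 2 * eLpNorm f p volume := by
          rw [two_mul]
          congr 1
          exact eLpNorm_comp_measurePreserving hfm hmp
      _ ≤ 1 * (2 * eLpNorm f p volume + eLpNorm (fderiv ℝ f) p volume) := by
          rw [one_mul]
          exact le_self_add
      _ ≤ _ := by gcongr
  · have hle : ‖h‖ ≤ ‖h‖ ^ ((1 : ℝ) / 3) := by
      rcases eq_or_ne h 0 with rfl | hh
      · rw [norm_zero]
        positivity
      · simpa using Real.rpow_le_rpow_of_exponent_ge (norm_pos_iff.2 hh) h1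
          (show (1 : ℝ) / 3 ≤ 1 by norm_num)
    have hn : ‖((0, h, 0) : Pt d)‖ = ‖h‖ := by simp [Prod.norm_def]
    calc _ ≤ eLpNorm (fun z => fderiv ℝ f z ((0, h, 0) : Pt d)) p volume :=
          eLpNorm_sub_comp_add_le hp hf _
      _ ≤ ENNReal.ofReal ‖h‖ * eLpNorm (fderiv ℝ f) p volume := by
          refine eLpNorm_le_mul_eLpNorm_of_ae_le_mul (.of_forall fun z => ?_) p
          simpa [hn, mul_comm] using (fderiv ℝ f z).le_opNorm ((0, h, 0) : Pt d)
      _ ≤ _ := by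
          gcongr
          exact le_add_self

/-- A finite best constant in a Hölder-type bound that reproduces itself with a factor `1/2`
is controlled by the remaining term. -/
lemma le_mul_of_self_improving {ι : Type*} {a w : ι → ℝ≥0∞} {M N : ℝ≥0∞}
    (hw : ∀ i, w i ≠ ∞) (hM : M ≠ ∞) (hbound : ∀ i, a i ≤ w i * M)
    (himp : ∀ B : ℝ≥0∞, (∀ i, a i ≤ w i * B) → ∀ i, a i ≤ w i * (N + B / 2)) (i : ι) :
    a i ≤ w i * (2 * N) := by
  have hS : ∀ i, a i ≤ w i * sInf {B : ℝ≥0∞ | ∀ i, a i ≤ w i * B} := fun i => by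
    have : Nonempty {B : ℝ≥0∞ | ∀ i, a i ≤ w i * B} := ⟨⟨M, hbound⟩⟩
    rw [sInf_eq_iInf', ENNReal.mul_iInf fun h => absurd h (hw i)]
    exact le_iInf fun B => B.2 i
  set B := sInf {B : ℝ≥0∞ | ∀ i, a i ≤ w i * B} with hB
  have hBt : B ≠ ∞ := ne_top_of_le_ne_top hM (sInf_le hbound)
  have hle : B / 2 + B / 2 ≤ N + B / 2 := by
    rw [ENNReal.add_halves]
    exact sInf_le (himp B hS)
  have hhalf : B / 2 ≤ N :=
    (ENNReal.add_le_add_iff_right (ENNReal.div_ne_top hBt two_ne_zero)).1 hle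
  refine (hS i).trans ?_
  gcongr
  rw [mul_comm]
  exact (ENNReal.div_le_iff two_ne_zero ENNReal.ofNat_ne_top).1 hhalf

end Absorption

/-- **Theorem 3.1: transfer of regularity in Hörmander's Besov scale.**
Let `Q = 4d+2`, `p ∈ [Q/(Q−1), ∞]` and `1/q = 1/p + 1/Q`. There is `C = C(d,p) > 0`
such that for every Schwartz `f` with `(∂_t + v·∇_x) f = ∇_v · S₀ + S₁`, `S₀, S₁` Schwartz,
`sup_{h ≠ 0} |h|^{−1/3} ‖Δ_x^h f‖_{L^p} ≤ C (‖S₀‖_{L^p} + ‖∇_v f‖_{L^p} + ‖S₁‖_{L^q})`. -/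
theorem statement14 (d : ℕ) (hd : 1 ≤ d) (p q : ℝ≥0∞)
    (hp : ENNReal.ofReal ((4 * (d : ℝ) + 2) / (4 * (d : ℝ) + 1)) ≤ p)
    (hq : 1 / q = 1 / p + (((4 * d + 2 : ℕ) : ℝ≥0∞))⁻¹) :
    ∃ C : ℝ, 0 < C ∧
      ∀ (f : SchwartzMap (Pt d) ℝ) (S0 : SchwartzMap (Pt d) (V d))
        (S1 : SchwartzMap (Pt d) ℝ),
        (∀ z : Pt d, fderiv ℝ (⇑f) z (1, z.2.2, 0) =
          (∑ i : Fin d, fderiv ℝ (⇑S0) z (0, 0, EuclideanSpace.single i 1) i) + S1 z) →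
        ∀ h : V d, h ≠ 0 →
          eLpNorm (fun z : Pt d => f (z.1, z.2.1 + h, z.2.2) - f z) p volume ≤
            ENNReal.ofReal (C * ‖h‖ ^ ((1 : ℝ) / 3)) *
              (eLpNorm (⇑S0) p volume + eLpNorm (gradV (⇑f)) p volume +
                eLpNorm (⇑S1) q volume) := by
  have hq1 : 1 ≤ q := one_le_of_one_div_eq_add hp hq
  have hqp : q ≤ p := by
    rw [← ENNReal.inv_le_inv, ← one_div, ← one_div q, hq]
    exact le_self_add
  have hqt : q ≠ ∞ := by
    rintro rfl
    rw [one_div, ENNReal.inv_top, eq_comm, add_eq_zero] at hq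
    exact ENNReal.inv_ne_zero.2 (ENNReal.natCast_ne_top _) hq.2
  obtain ⟨C, hC, H⟩ := exists_position_shift_bound d hq1 hqp hqt hq
  refine ⟨(2 * C).toReal + 1, by positivity, fun f S0 S1 heq h _ => ?_⟩
  have hf : ContDiff ℝ 1 f := f.smooth 1
  have hM : 2 * eLpNorm f p volume + eLpNorm (fderiv ℝ f) p volume ≠ ∞ := by
    refine ENNReal.add_ne_top.2 ⟨ENNReal.mul_ne_top ENNReal.ofNat_ne_top
      (f.memLp p volume).eLpNorm_ne_top, ?_⟩
    exact ((SchwartzMap.fderivCLM ℝ (Pt d) ℝ f).memLp p volume).eLpNorm_ne_top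
  have key := le_mul_of_self_improving (fun k : V d => ENNReal.ofReal_ne_top) hM
    (eLpNorm_position_shift_le (hq1.trans hqp) hf)
    (N := C * (eLpNorm S0 p volume + eLpNorm (gradV f) p volume + eLpNorm S1 q volume))
    (fun B hB k => by
      rcases eq_or_ne k 0 with rfl | hk
      · simp
      · exact H f S0 S1 hf (S0.smooth 1) S1.continuous heq B hB k hk) h
  refine key.trans ?_
  rw [mul_comm ((2 * C).toReal + 1), ENNReal.ofReal_mul (by positivity), mul_assoc, ← mul_assoc 2]
  gcongr
  calc 2 * C = ENNReal.ofReal (2 * C).toReal :=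
        (ENNReal.ofReal_toReal (ENNReal.mul_ne_top ENNReal.ofNat_ne_top hC)).symm
    _ ≤ _ := ENNReal.ofReal_le_ofReal (by linarith)
end
end
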